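/- arXiv:1202.4976 — 2 statements merged into one kernel-verified Lean document; each statement's English description precedes it below -/
import Mathlib

section
/- Fix k ≥ 0, and for n ≥ 2 let mul_n(l) denote the multiplicity of l ∈ ℤ as an eigenvalue of the adjacency matrix of the Cayley graph G_n of 𝔖_n generated by (1 i), 2 ≤ i ≤ n. Then as n → ∞, the k-th moment (1/n!) · Σ_{l ∈ ℤ} mul_n(l) · (l/(2√n))^k converges to 0 if k is odd, and to Cat(p)/4^p if k = 2p is even, where Cat(p) = (2p)!/((p+1)! p!). These limits are exactly the moments (2/π) ∫_{−1}^{1} α^k √(1−α²) dα of the semicircle distribution. -/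
open Equiv Polynomial Filter

/-- The `p`-th Catalan number `Cat(p) = (2p)! / ((p+1)! p!)`. -/
def Cat (p : ℕ) : ℕ := (2 * p).factorial / ((p + 1).factorial * p.factorial)

/-- Adjacency matrix of the Cayley graph `G_n` of `𝔖_n = Perm (Fin n)` generated by the
transpositions `(1 i)` for `2 ≤ i ≤ n` (here `0 : Fin n` plays the role of the element `1`,
and the generators are `swap 0 i` for `i ≠ 0`). -/
noncomputable def adjMatn : (n : ℕ) → Matrix (Equiv.Perm (Fin n)) (Equiv.Perm (Fin n)) ℂ
  | 0 => 0
  | m + 1 => fun σ τ =>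
      if ∃ i : Fin (m + 1), i ≠ 0 ∧ τ * σ⁻¹ = Equiv.swap 0 i then 1 else 0

/-- The multiplicity of `l ∈ ℤ` as an eigenvalue of the adjacency matrix of `G_n`
(its multiplicity as a root of the characteristic polynomial). -/
noncomputable def muln (n : ℕ) (l : ℤ) : ℕ := ((adjMatn n).charpoly.roots).count (l : ℂ)

section Integrality

variable {α V : Type*} [DecidableEq α] [AddCommGroup V] [Module ℂ V]

/-- The image under a representation `ρ` of the sum of the transpositions `(c i)`, `i ∈ S`. -/
noncomputable def starSum (ρ : Perm α →* Module.End ℂ V) (c : α) (S : Finset α) :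
    Module.End ℂ V :=
  ∑ i ∈ S, ρ (swap c i)

lemma starSum_insert (ρ : Perm α →* Module.End ℂ V) (c : α) {d : α} {T : Finset α}
    (hd : d ∉ T) : starSum ρ c (insert d T) = ρ (swap c d) + starSum ρ c T :=
  Finset.sum_insert hd

lemma commute_starSum (ρ : Perm α →* Module.End ℂ V) {c d : α} {T : Finset α}
    (hcd : c ≠ d) (hc : c ∉ T) (hd : d ∉ T) :
    Commute (starSum ρ c (insert d T)) (starSum ρ d T) := by
  rw [starSum_insert ρ c hd]
  have key : ∀ i ∈ T, ρ (swap c i) * starSum ρ d T - starSum ρ d T * ρ (swap c i) =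
      ρ (swap d i) * ρ (swap c d) - ρ (swap c d) * ρ (swap d i) := by
    intro i hi
    have hic : c ≠ i := fun h => hc (h ▸ hi)
    have hid : d ≠ i := fun h => hd (h ▸ hi)
    have h1 : swap d i * swap c d = swap c i * swap d i := by
      rw [mul_swap_eq_swap_mul, swap_apply_of_ne_of_ne hcd hic, swap_apply_left]
    have h2 : swap d i * swap c i = swap c d * swap d i := by
      rw [mul_swap_eq_swap_mul, swap_apply_of_ne_of_ne hcd hic, swap_apply_right]
    rw [← map_mul, ← map_mul, h1, ← h2, starSum, Finset.mul_sum, Finset.sum_mul,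
      ← Finset.sum_sub_distrib, Finset.sum_eq_single_of_mem i hi, map_mul, map_mul]
    intro j hj hji
    have hjc : c ≠ j := fun h => hc (h ▸ hj)
    rw [← map_mul, ← map_mul, mul_swap_eq_swap_mul (swap c i) d j,
      swap_apply_of_ne_of_ne hcd.symm hid, swap_apply_of_ne_of_ne hjc.symm hji, sub_self]
  have hsum := Finset.sum_congr rfl key
  rw [Finset.sum_sub_distrib, Finset.sum_sub_distrib, ← Finset.sum_mul, ← Finset.mul_sum,
    ← Finset.sum_mul, ← Finset.mul_sum] at hsum
  change starSum ρ c T * starSum ρ d T - starSum ρ d T * starSum ρ c T =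
    starSum ρ d T * ρ (swap c d) - ρ (swap c d) * starSum ρ d T at hsum
  rw [Commute, SemiconjBy, add_mul, mul_add, ← sub_eq_zero]
  rw [← sub_eq_zero] at hsum
  rw [← hsum]
  abel

lemma starSum_mul_swap (ρ : Perm α →* Module.End ℂ V) {c d : α} {T : Finset α}
    (hc : c ∉ T) (hd : d ∉ T) :
    starSum ρ d T * ρ (swap c d) = ρ (swap c d) * starSum ρ c (insert d T) - 1 := by
  rw [starSum_insert ρ c hd, mul_add, ← map_mul, swap_mul_self, map_one, add_sub_cancel_left,
    starSum, starSum, Finset.sum_mul, Finset.mul_sum]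
  refine Finset.sum_congr rfl fun i hi => ?_
  have hic : i ≠ c := fun h => hc (h ▸ hi)
  have hid : i ≠ d := fun h => hd (h ▸ hi)
  rw [← map_mul, ← map_mul, mul_swap_eq_swap_mul (swap c d), swap_apply_left,
    swap_apply_of_ne_of_ne hic hid]

/-- Commuting endomorphisms have a common eigenvector for each eigenvalue of one of them. -/
lemma exists_common_eigenvector [FiniteDimensional ℂ V] {f g : Module.End ℂ V}
    (hfg : Commute f g) {μ : ℂ} (hμ : f.HasEigenvalue μ) :
    ∃ (ν : ℂ) (v : V), v ≠ 0 ∧ f v = μ • v ∧ g v = ν • v := by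
  have hmaps : Set.MapsTo g (f.eigenspace μ) (f.eigenspace μ) := by
    intro v hv
    rw [SetLike.mem_coe, Module.End.mem_eigenspace_iff] at hv ⊢
    rw [← Module.End.mul_apply, hfg.eq, Module.End.mul_apply, hv, map_smul]
  have : Nontrivial (f.eigenspace μ) := Submodule.nontrivial_iff_ne_bot.mpr hμ
  obtain ⟨ν, hν⟩ := Module.End.exists_eigenvalue (LinearMap.restrict g hmaps)
  obtain ⟨v, hv⟩ := hν.exists_hasEigenvector
  refine ⟨ν, v, fun h => hv.2 (Subtype.ext h), Module.End.mem_eigenspace_iff.mp v.2, ?_⟩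
  exact congrArg Subtype.val hv.apply_eq_smul

theorem starSum_eigenvalue_int [FiniteDimensional ℂ V] (ρ : Perm α →* Module.End ℂ V)
    (S : Finset α) :
    ∀ c ∉ S, ∀ μ : ℂ, (starSum ρ c S).HasEigenvalue μ → ∃ l : ℤ, μ = l := by
  induction S using Finset.induction_on with
  | empty =>
    intro c _ μ hμ
    obtain ⟨v, hv⟩ := hμ.exists_hasEigenvector
    have h := hv.apply_eq_smul
    simp only [starSum, Finset.sum_empty, LinearMap.zero_apply] at h
    exact ⟨0, by simpa [hv.2] using h.symm⟩
  | insert d T hd ih =>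
    intro c hc μ hμ
    have hcd : c ≠ d := fun h => hc (h ▸ Finset.mem_insert_self _ _)
    have hcT : c ∉ T := fun h => hc (Finset.mem_insert_of_mem h)
    obtain ⟨a, v, hv0, hvμ, hva⟩ := exists_common_eigenvector (commute_starSum ρ hcd hcT hd) hμ
    have eigen : ∀ (b : ℂ) (w : V), w ≠ 0 → starSum ρ d T w = b • w → ∃ l : ℤ, b = l :=
      fun b w hw h => ih d hd b (Module.End.hasEigenvalue_of_hasEigenvector
        (Module.End.hasEigenvector_iff.mpr ⟨Module.End.mem_eigenspace_iff.mpr h, hw⟩))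
    obtain ⟨la, hla⟩ := eigen a v hv0 hva
    have hs : starSum ρ d T (ρ (swap c d) v) = μ • ρ (swap c d) v - v := by
      have h := LinearMap.congr_fun (starSum_mul_swap ρ hcT hd) v
      simpa [hvμ] using h
    by_cases hw : (μ - a) • ρ (swap c d) v - v = 0
    · rw [sub_eq_zero] at hw
      have hss : ρ (swap c d) (ρ (swap c d) v) = v := by
        rw [← Module.End.mul_apply, ← map_mul, swap_mul_self, map_one, Module.End.one_apply]
      have hsv : (μ - a) • v = ρ (swap c d) v := by
        conv_rhs => rw [← hw, map_smul, hss]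
      have h2 : ((μ - a) * (μ - a) - 1) • v = 0 := by
        rw [sub_smul, one_smul, mul_smul, hsv, hw, sub_self]
      have h4 : (μ - a - 1) * (μ - a + 1) = 0 := by
        have := (smul_eq_zero.mp h2).resolve_right hv0
        linear_combination this
      rcases mul_eq_zero.mp h4 with h | h
      · exact ⟨la + 1, by push_cast; rw [← hla]; linear_combination h⟩
      · exact ⟨la - 1, by push_cast; rw [← hla]; linear_combination h⟩
    · refine eigen μ _ hw ?_
      rw [map_sub, map_smul, hs, hva]
      module

end Integrality

section Matrix

variable {m : ℕ}

lemma adjMatn_sum_mul (σ : Perm (Fin (m + 1))) (f : Perm (Fin (m + 1)) → ℂ) :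
    ∑ τ, adjMatn (m + 1) σ τ * f τ = ∑ i ∈ Finset.univ.erase 0, f (swap 0 i * σ) := by
  classical
  have hinj : Function.Injective fun i : Fin (m + 1) => swap 0 i * σ := by
    intro i j h
    simpa using congrArg (fun π : Perm (Fin (m + 1)) => π 0) (mul_right_cancel h)
  rw [← Finset.sum_image (g := fun i => swap 0 i * σ) hinj.injOn (f := f)]
  simp only [adjMatn, ite_mul, one_mul, zero_mul]
  rw [← Finset.sum_filter]
  congr 1
  ext τ
  simp [mul_inv_eq_iff_eq_mul, eq_comm]

lemma adjMatn_isHermitian : (adjMatn (m + 1)).IsHermitian := by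
  ext σ τ
  rw [Matrix.conjTranspose_apply]
  simp only [adjMatn, apply_ite star, star_one, star_zero]
  have h : ∀ i : Fin (m + 1), σ * τ⁻¹ = swap 0 i ↔ τ * σ⁻¹ = swap 0 i := by
    intro i
    rw [← inv_inj, mul_inv_rev, inv_inv, swap_inv]
  simp only [h]

/-- The left regular representation of a permutation group, on functions. -/
def leftRegularEnd (m : ℕ) :
    Perm (Fin (m + 1)) →* Module.End ℂ (Perm (Fin (m + 1)) → ℂ) where
  toFun g := LinearMap.funLeft ℂ ℂ fun x => g⁻¹ * x
  map_one' := by ext; simp [LinearMap.funLeft]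
  map_mul' g h := by ext; simp [LinearMap.funLeft, mul_assoc]

lemma toLin'_adjMatn :
    Matrix.toLin' (adjMatn (m + 1)) = starSum (leftRegularEnd m) 0 (Finset.univ.erase 0) := by
  refine LinearMap.ext fun f => funext fun σ => ?_
  rw [Matrix.toLin'_apply, Matrix.mulVec, dotProduct, adjMatn_sum_mul]
  simp [starSum, leftRegularEnd, LinearMap.funLeft_apply]

lemma adjMatn_root_int {μ : ℂ} (hμ : μ ∈ (adjMatn (m + 1)).charpoly.roots) :
    ∃ l : ℤ, μ = l := by
  refine starSum_eigenvalue_int (leftRegularEnd m) (Finset.univ.erase 0) 0 (by simp) μ ?_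
  rw [← toLin'_adjMatn, Module.End.hasEigenvalue_iff_isRoot_charpoly, Matrix.charpoly_toLin']
  exact Polynomial.isRoot_of_mem_roots hμ

/-- The number of words of length `j` in the transpositions `(0 i)` whose product is `π⁻¹`. -/
def starWalks (m : ℕ) : ℕ → Perm (Fin (m + 1)) → ℕ
  | 0, π => if π = 1 then 1 else 0
  | j + 1, π => ∑ i ∈ Finset.univ.erase 0, starWalks m j (swap 0 i * π)

lemma adjMatn_pow_apply (j : ℕ) (σ τ : Perm (Fin (m + 1))) :
    (adjMatn (m + 1) ^ j) σ τ = starWalks m j (σ * τ⁻¹) := by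
  induction j generalizing σ with
  | zero => simp [starWalks, Matrix.one_apply, mul_inv_eq_one]
  | succ j ih =>
    rw [pow_succ', Matrix.mul_apply, adjMatn_sum_mul σ fun ρ => (adjMatn (m + 1) ^ j) ρ τ]
    simp [ih, starWalks, mul_assoc]

lemma trace_adjMatn_pow (k : ℕ) :
    (adjMatn (m + 1) ^ k).trace = (m + 1).factorial * starWalks m k 1 := by
  simp [Matrix.trace, adjMatn_pow_apply, Fintype.card_perm]

lemma Matrix.IsHermitian.trace_pow_eq_sum {n : Type*} [Fintype n] [DecidableEq n]
    {A : Matrix n n ℂ} (hA : A.IsHermitian) (k : ℕ) :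
    (A ^ k).trace = ∑ i, (hA.eigenvalues i : ℂ) ^ k := by
  conv_lhs => rw [hA.spectral_theorem, ← map_pow, Unitary.conjStarAlgAut_apply,
    Matrix.trace_mul_cycle, Matrix.diagonal_pow]
  simp [Matrix.trace]

lemma tsum_card_fiber_mul {ι : Type*} [Fintype ι] (g : ι → ℤ) (f : ℤ → ℝ) :
    ∑' z : ℤ, ((Finset.univ.filter fun i => g i = z).card : ℝ) * f z = ∑ i, f (g i) := by
  classical
  rw [tsum_eq_sum (s := Finset.univ.image g),
    ← Finset.sum_fiberwise_of_maps_to (g := g) (t := Finset.univ.image g) (by simp)]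
  · refine Finset.sum_congr rfl fun z _ => ?_
    rw [Finset.sum_congr rfl (g := fun _ => f z) (by simp +contextual), Finset.sum_const, nsmul_eq_mul]
  · intro z hz
    rw [Finset.filter_eq_empty_iff.mpr] <;> simp_all

lemma tsum_muln_mul_pow (k : ℕ) :
    ∑' l : ℤ, (muln (m + 1) l : ℝ) * (l : ℝ) ^ k =
      (m + 1).factorial * (starWalks m k 1 : ℝ) := by
  have hA : (adjMatn (m + 1)).IsHermitian := adjMatn_isHermitian
  have hroots := hA.roots_charpoly_eq_eigenvalues
  have hint : ∀ i, ∃ l : ℤ, hA.eigenvalues i = l := by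
    intro i
    obtain ⟨l, hl⟩ := adjMatn_root_int (m := m) (μ := (hA.eigenvalues i : ℂ)) (by
      rw [hroots]
      exact Multiset.mem_map_of_mem _ (Finset.mem_univ_val i))
    exact ⟨l, by exact_mod_cast hl⟩
  choose g hg using hint
  have hmul : ∀ l : ℤ, muln (m + 1) l = (Finset.univ.filter fun i => g i = l).card := by
    intro l
    rw [muln, hroots, Multiset.count_map]
    simp only [Finset.card, Finset.filter_val, Function.comp_apply, hg]
    congr 2
    ext i
    simp [eq_comm]
  simp only [hmul]
  rw [tsum_card_fiber_mul g fun l => (l : ℝ) ^ k]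
  have htr := (hA.trace_pow_eq_sum k).symm.trans (trace_adjMatn_pow k)
  simp only [← hg]
  exact_mod_cast htr

lemma moment_eq (k : ℕ) :
    (1 / ((m + 1).factorial : ℝ)) *
        ∑' l : ℤ, (muln (m + 1) l : ℝ) * ((l : ℝ) / (2 * Real.sqrt (m + 1 : ℕ))) ^ k =
      starWalks m k 1 / Real.sqrt (m + 1 : ℕ) ^ k / 2 ^ k := by
  simp only [div_pow, mul_div_assoc']
  rw [tsum_div_const, tsum_muln_mul_pow, mul_pow]
  have : ((m + 1).factorial : ℝ) ≠ 0 := by positivity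
  field_simp

end Matrix

section Counting

variable {m : ℕ}

/-- The nonzero points moved by `π`. -/
def moved (π : Perm (Fin (m + 1))) : Finset (Fin (m + 1)) :=
  (Finset.univ.erase 0).filter fun i => ¬ π i = i

lemma mem_moved {π : Perm (Fin (m + 1))} {i : Fin (m + 1)} :
    i ∈ moved π ↔ i ≠ 0 ∧ π i ≠ i := by
  simp [moved]

lemma moved_one : moved (1 : Perm (Fin (m + 1))) = ∅ := by
  simp [moved]

lemma swap_mul_apply_eq_iff {π : Perm (Fin (m + 1))} {i x : Fin (m + 1)} (hx : x ≠ 0)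
    (hxi : x ≠ i) : (swap 0 i * π) x = x ↔ π x = x := by
  rw [Perm.mul_apply, ← Equiv.eq_symm_apply, symm_swap, swap_apply_of_ne_of_ne hx hxi]

lemma moved_swap_mul_of_fixed {π : Perm (Fin (m + 1))} {i : Fin (m + 1)} (hi : i ≠ 0)
    (h : π i = i) : moved (swap 0 i * π) = insert i (moved π) := by
  ext x
  by_cases hxi : x = i
  · subst hxi
    simp [mem_moved, hi, h, hi.symm]
  · by_cases hx : x = 0
    · simp [mem_moved, hx, hi.symm]
    · simp only [mem_moved, Finset.mem_insert, Ne, swap_mul_apply_eq_iff hx hxi, hxi, false_or]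

lemma card_moved_swap_mul_of_fixed {π : Perm (Fin (m + 1))} {i : Fin (m + 1)} (hi : i ≠ 0)
    (h : π i = i) : (moved (swap 0 i * π)).card = (moved π).card + 1 := by
  rw [moved_swap_mul_of_fixed hi h, Finset.card_insert_of_notMem (by simp [mem_moved, h])]

lemma moved_swap_mul_of_moved {π : Perm (Fin (m + 1))} {i : Fin (m + 1)} (hi : i ≠ 0)
    (h : π i ≠ i) (h0 : π i ≠ 0) : moved (swap 0 i * π) = moved π := by
  ext x
  by_cases hxi : x = i
  · subst hxi
    simp [mem_moved, h, swap_apply_of_ne_of_ne h0 h]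
  · by_cases hx : x = 0
    · simp [mem_moved, hx]
    · simp only [mem_moved, Ne, swap_mul_apply_eq_iff hx hxi]

lemma card_moved_le (π : Perm (Fin (m + 1))) (i : Fin (m + 1)) :
    (moved π).card ≤ (moved (swap 0 i * π)).card + 1 := by
  have hsub : moved π ⊆ insert i (moved (swap 0 i * π)) := by
    intro x hx
    rw [mem_moved] at hx
    by_cases hxi : x = i
    · simp [hxi]
    · exact Finset.mem_insert_of_mem
        (mem_moved.mpr ⟨hx.1, fun h => hx.2 ((swap_mul_apply_eq_iff hx.1 hxi).mp h)⟩)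
  exact (Finset.card_le_card hsub).trans (Finset.card_insert_le _ _)

lemma starWalks_eq_zero {j : ℕ} {π : Perm (Fin (m + 1))} (h : j < (moved π).card) :
    starWalks m j π = 0 := by
  induction j generalizing π with
  | zero =>
    rw [starWalks, if_neg]
    rintro rfl
    simp [moved_one] at h
  | succ j ih =>
    rw [starWalks]
    refine Finset.sum_eq_zero fun i _ => ih ?_
    have := card_moved_le π i
    omega

lemma starWalks_succ (j : ℕ) (π : Perm (Fin (m + 1))) :
    (starWalks m (j + 1) π : ℝ) =
      ∑ i ∈ (Finset.univ.erase 0).filter (fun i => π i = i), (starWalks m j (swap 0 i * π) : ℝ) +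
        ∑ i ∈ moved π, (starWalks m j (swap 0 i * π) : ℝ) := by
  rw [starWalks, moved, Finset.sum_filter_add_sum_filter_not]
  push_cast
  rfl

lemma card_fixed_add_card_moved (π : Perm (Fin (m + 1))) :
    ((Finset.univ.erase 0).filter fun i => π i = i).card + (moved π).card = m := by
  rw [moved, Finset.card_filter_add_card_filter_not]
  simp

lemma one_le_sqrt_succ (m : ℕ) : 1 ≤ Real.sqrt (m + 1 : ℕ) := by
  rw [Real.one_le_sqrt]
  exact_mod_cast Nat.succ_pos m

lemma starWalks_bound (j : ℕ) : ∃ C : ℝ, 0 ≤ C ∧ ∀ (m : ℕ) (π : Perm (Fin (m + 1))),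
    starWalks m j π * Real.sqrt (m + 1 : ℕ) ^ (moved π).card ≤ C * Real.sqrt (m + 1 : ℕ) ^ j := by
  induction j with
  | zero =>
    refine ⟨1, zero_le_one, fun m π => ?_⟩
    by_cases h : π = 1
    · simp [starWalks, h, moved_one]
    · simp [starWalks, h]
  | succ j ih =>
    obtain ⟨C, hC, ih⟩ := ih
    refine ⟨C + (j + 1) * C, by positivity, fun m π => ?_⟩
    have hq : 1 ≤ Real.sqrt (m + 1 : ℕ) := one_le_sqrt_succ m
    have hq2 : Real.sqrt (m + 1 : ℕ) ^ 2 = m + 1 := by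
      rw [Real.sq_sqrt (by positivity)]
      push_cast
      rfl
    set q := Real.sqrt (m + 1 : ℕ)
    have hq0 : 0 < q := by linarith
    rcases lt_or_ge (j + 1) (moved π).card with hlt | hle
    · rw [starWalks_eq_zero hlt]
      simp only [Nat.cast_zero, zero_mul]
      positivity
    rw [starWalks_succ, add_mul, add_mul, Finset.sum_mul, Finset.sum_mul]
    refine add_le_add ?_ ?_
    · have hterm : ∀ i ∈ (Finset.univ.erase 0).filter (fun i => π i = i),
          (starWalks m j (swap 0 i * π) : ℝ) * q ^ (moved π).card ≤ C * q ^ j / q := by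
        intro i hi
        simp only [Finset.mem_filter, Finset.mem_erase, Finset.mem_univ, and_true] at hi
        have h := ih m (swap 0 i * π)
        rw [card_moved_swap_mul_of_fixed hi.1 hi.2, pow_succ, ← mul_assoc] at h
        rwa [le_div_iff₀ hq0]
      refine (Finset.sum_le_card_nsmul _ _ _ hterm).trans ?_
      have hcard : (((Finset.univ.erase 0).filter fun i => π i = i).card : ℝ) ≤ q ^ 2 := by
        have h : (((Finset.univ.erase 0).filter fun i => π i = i).card : ℝ) ≤ m := by
          exact_mod_cast (Nat.le_add_right _ _).trans (card_fixed_add_card_moved π).le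
        linarith
      calc _ ≤ q ^ 2 * (C * q ^ j / q) := by
            rw [nsmul_eq_mul]
            gcongr
        _ = C * q ^ (j + 1) := by
            field_simp
            ring
    · have hterm : ∀ i ∈ moved π,
          (starWalks m j (swap 0 i * π) : ℝ) * q ^ (moved π).card ≤ C * q ^ (j + 1) := by
        intro i _
        calc _ ≤ (starWalks m j (swap 0 i * π) : ℝ) *
              q ^ ((moved (swap 0 i * π)).card + 1) := by
              gcongr
              exact card_moved_le π i
          _ = (starWalks m j (swap 0 i * π) : ℝ) * q ^ (moved (swap 0 i * π)).card * q := by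
              rw [pow_succ, mul_assoc]
          _ ≤ C * q ^ j * q := by
              exact mul_le_mul_of_nonneg_right (ih m _) hq0.le
          _ = C * q ^ (j + 1) := by ring
      refine (Finset.sum_le_card_nsmul _ _ _ hterm).trans ?_
      rw [nsmul_eq_mul, ← mul_assoc]
      gcongr
      exact_mod_cast hle

/-- `IsStarCycle r π` says that `π` is a cycle of length `r + 1` through `0`
(the identity if `r = 0`). -/
inductive IsStarCycle {m : ℕ} : ℕ → Perm (Fin (m + 1)) → Prop
  | one : IsStarCycle 0 1
  | swap_mul {r : ℕ} {σ : Perm (Fin (m + 1))} {i : Fin (m + 1)} (hi : i ≠ 0) (h : σ i = i)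
      (hσ : IsStarCycle r σ) : IsStarCycle (r + 1) (swap 0 i * σ)

lemma IsStarCycle.card_moved {r : ℕ} {π : Perm (Fin (m + 1))} (h : IsStarCycle r π) :
    (moved π).card = r := by
  induction h with
  | one => simp [moved_one]
  | swap_mul hi h _ ih => rw [card_moved_swap_mul_of_fixed hi h, ih]

/-- The number of nonnegative lattice paths with `j` steps `±1` from `r` to `0`. -/
def ballotPaths : ℕ → ℕ → ℕ
  | 0, 0 => 1
  | 0, _ + 1 => 0
  | j + 1, 0 => ballotPaths j 1
  | j + 1, r + 1 => ballotPaths j (r + 2) + ballotPaths j r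

lemma sum_fixed_starWalks_approx {j r : ℕ} {C : ℝ} {π : Perm (Fin (m + 1))} (hC : 0 ≤ C)
    (hπ : IsStarCycle r π)
    (hA : ∀ σ : Perm (Fin (m + 1)), IsStarCycle (r + 1) σ →
      |starWalks m j σ * Real.sqrt (m + 1 : ℕ) ^ (r + 2) -
        ballotPaths j (r + 1) * Real.sqrt (m + 1 : ℕ) ^ (j + 1)| ≤
          C * Real.sqrt (m + 1 : ℕ) ^ j) :
    |(∑ i ∈ (Finset.univ.erase 0).filter (fun i => π i = i),
        (starWalks m j (swap 0 i * π) : ℝ)) * Real.sqrt (m + 1 : ℕ) ^ (r + 1) -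
      ballotPaths j (r + 1) * Real.sqrt (m + 1 : ℕ) ^ (j + 2)| ≤
        (C + (r + 1) * ballotPaths j (r + 1)) * Real.sqrt (m + 1 : ℕ) ^ (j + 1) := by
  have hq : 1 ≤ Real.sqrt (m + 1 : ℕ) := one_le_sqrt_succ m
  have hq2 : Real.sqrt (m + 1 : ℕ) ^ 2 = m + 1 := by
    rw [Real.sq_sqrt (by positivity)]
    push_cast
    rfl
  set q := Real.sqrt (m + 1 : ℕ)
  have hq0 : 0 < q := by linarith
  set F := (Finset.univ.erase 0).filter (fun i => π i = i) with hF
  set d : ℝ := (ballotPaths j (r + 1) : ℝ) with hd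
  have hd0 : 0 ≤ d := Nat.cast_nonneg _
  set A := ∑ i ∈ F, (starWalks m j (swap 0 i * π) : ℝ) with hAdef
  have hcard : (F.card : ℝ) = q ^ 2 - 1 - r := by
    have h := card_fixed_add_card_moved π
    rw [hπ.card_moved, ← hF] at h
    have h' : (F.card : ℝ) + r = m := by exact_mod_cast h
    rw [hq2]
    linarith
  have h1 : |A * q ^ (r + 2) - F.card * (d * q ^ (j + 1))| ≤ F.card * (C * q ^ j) := by
    rw [hAdef, Finset.sum_mul, ← nsmul_eq_mul F.card (d * q ^ (j + 1)), ← Finset.sum_const,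
      ← Finset.sum_sub_distrib]
    refine (Finset.abs_sum_le_sum_abs _ _).trans ?_
    rw [← nsmul_eq_mul F.card]
    refine Finset.sum_le_card_nsmul _ _ _ fun i hi => hA _ ?_
    simp only [hF, Finset.mem_filter, Finset.mem_erase, Finset.mem_univ, and_true] at hi
    exact .swap_mul hi.1 hi.2 hπ
  have h2 : (F.card : ℝ) * (C * q ^ j) ≤ q ^ 2 * (C * q ^ j) := by
    gcongr
    rw [hcard]
    have : (0 : ℝ) ≤ r := Nat.cast_nonneg _
    linarith
  have h3 : (r + 1) * d * q ^ (j + 1) ≤ (r + 1) * d * q ^ (j + 2) := by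
    gcongr
    exact one_le_two
  refine le_of_mul_le_mul_left ?_ hq0
  calc q * |A * q ^ (r + 1) - d * q ^ (j + 2)|
      = |(A * q ^ (r + 2) - F.card * (d * q ^ (j + 1))) + -((r + 1) * d * q ^ (j + 1))| := by
        rw [← abs_of_pos hq0, ← abs_mul, abs_of_pos hq0, hcard]
        ring_nf
    _ ≤ |A * q ^ (r + 2) - F.card * (d * q ^ (j + 1))| + |-((r + 1) * d * q ^ (j + 1))| :=
        abs_add_le _ _
    _ ≤ q ^ 2 * (C * q ^ j) + (r + 1) * d * q ^ (j + 2) := by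
        rw [abs_neg, abs_of_nonneg (a := (r + 1) * d * q ^ (j + 1)) (by positivity)]
        linarith
    _ = q * ((C + (r + 1) * d) * q ^ (j + 1)) := by ring

lemma sum_moved_starWalks_approx {j r : ℕ} {B C : ℝ} {π : Perm (Fin (m + 1))}
    (hπ : IsStarCycle (r + 1) π)
    (hB : ∀ σ : Perm (Fin (m + 1)),
      starWalks m j σ * Real.sqrt (m + 1 : ℕ) ^ (moved σ).card ≤ B * Real.sqrt (m + 1 : ℕ) ^ j)
    (hA : ∀ σ : Perm (Fin (m + 1)), IsStarCycle r σ →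
      |starWalks m j σ * Real.sqrt (m + 1 : ℕ) ^ (r + 1) -
        ballotPaths j r * Real.sqrt (m + 1 : ℕ) ^ (j + 1)| ≤ C * Real.sqrt (m + 1 : ℕ) ^ j) :
    |(∑ i ∈ moved π, (starWalks m j (swap 0 i * π) : ℝ)) * Real.sqrt (m + 1 : ℕ) ^ (r + 2) -
      ballotPaths j r * Real.sqrt (m + 1 : ℕ) ^ (j + 2)| ≤
        (C + r * B) * Real.sqrt (m + 1 : ℕ) ^ (j + 1) := by
  have hq : 1 ≤ Real.sqrt (m + 1 : ℕ) := one_le_sqrt_succ m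
  set q := Real.sqrt (m + 1 : ℕ)
  have hq0 : 0 < q := by linarith
  have hcard := hπ.card_moved
  obtain ⟨i₀, σ, hi₀, hσi, hσ, rfl⟩ : ∃ i₀ σ, i₀ ≠ 0 ∧ σ i₀ = i₀ ∧ IsStarCycle r σ ∧
      π = swap 0 i₀ * σ := by
    cases hπ with
    | swap_mul hi h hσ => exact ⟨_, _, hi, h, hσ, rfl⟩
  set π := swap 0 i₀ * σ with hπdef
  have hπi₀ : π i₀ = 0 := by simp [hπdef, hσi]
  have hmem : i₀ ∈ moved π := mem_moved.mpr ⟨hi₀, by rw [hπi₀]; exact hi₀.symm⟩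
  have hback : swap 0 i₀ * π = σ := by rw [hπdef, swap_mul_self_mul]
  rw [← Finset.add_sum_erase _ _ hmem, hback]
  set E := ∑ i ∈ (moved π).erase i₀, (starWalks m j (swap 0 i * π) : ℝ) with hE
  have hE0 : 0 ≤ E := Finset.sum_nonneg fun _ _ => Nat.cast_nonneg _
  have hE1 : E * q ^ (r + 1) ≤ r * (B * q ^ j) := by
    rw [hE, Finset.sum_mul]
    refine (Finset.sum_le_card_nsmul _ _ (B * q ^ j) fun i hi => ?_).trans ?_
    · rw [Finset.mem_erase, mem_moved] at hi
      have h0 : π i ≠ 0 := fun h => hi.1 (π.injective (h.trans hπi₀.symm))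
      have h := hB (swap 0 i * π)
      rwa [moved_swap_mul_of_moved hi.2.1 hi.2.2 h0, hcard] at h
    · rw [nsmul_eq_mul, Finset.card_erase_of_mem hmem, hcard, Nat.add_sub_cancel]
  calc |(starWalks m j σ + E) * q ^ (r + 2) - ballotPaths j r * q ^ (j + 2)|
      = q * |(starWalks m j σ * q ^ (r + 1) - ballotPaths j r * q ^ (j + 1)) +
          E * q ^ (r + 1)| := by
        rw [← abs_of_pos hq0, ← abs_mul, abs_of_pos hq0]
        ring_nf
    _ ≤ q * (C * q ^ j + r * (B * q ^ j)) := by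
        gcongr
        refine (abs_add_le _ _).trans (add_le_add (hA σ hσ) ?_)
        rwa [abs_of_nonneg (by positivity)]
    _ = (C + r * B) * q ^ (j + 1) := by ring

theorem starWalks_approx (j r : ℕ) : ∃ C : ℝ, 0 ≤ C ∧
    ∀ (m : ℕ) (π : Perm (Fin (m + 1))), IsStarCycle r π →
      |starWalks m j π * Real.sqrt (m + 1 : ℕ) ^ (r + 1) -
        ballotPaths j r * Real.sqrt (m + 1 : ℕ) ^ (j + 1)| ≤ C * Real.sqrt (m + 1 : ℕ) ^ j := by
  induction j generalizing r with
  | zero =>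
    refine ⟨0, le_rfl, fun m π hπ => ?_⟩
    cases r with
    | zero =>
      cases hπ
      simp [starWalks, ballotPaths]
    | succ r =>
      rw [starWalks_eq_zero (by rw [hπ.card_moved]; exact Nat.succ_pos r)]
      simp [ballotPaths]
  | succ j ih =>
    obtain ⟨B, hB0, hB⟩ := starWalks_bound j
    obtain ⟨C, hC0, hC⟩ := ih (r + 1)
    cases r with
    | zero =>
      refine ⟨C + ((0 : ℕ) + 1) * ballotPaths j 1, by positivity, fun m π hπ => ?_⟩
      have h := sum_fixed_starWalks_approx hC0 hπ (hC m)
      have hmoved : moved π = ∅ := Finset.card_eq_zero.mp hπ.card_moved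
      rw [starWalks_succ, hmoved, Finset.sum_empty, add_zero]
      exact h
    | succ r =>
      obtain ⟨D, hD0, hD⟩ := ih r
      refine ⟨(C + ((r + 1 : ℕ) + 1) * ballotPaths j (r + 2)) + (D + r * B), by positivity,
        fun m π hπ => ?_⟩
      have h1 := sum_fixed_starWalks_approx hC0 hπ (hC m)
      have h2 := sum_moved_starWalks_approx hπ (hB m) (hD m)
      rw [starWalks_succ, ballotPaths, Nat.cast_add (ballotPaths j (r + 2)), add_mul, add_mul,
        add_sub_add_comm, add_mul]
      exact (abs_add_le _ _).trans (add_le_add h1 h2)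

theorem tendsto_starWalks (k : ℕ) :
    Tendsto (fun m : ℕ => (starWalks m k 1 : ℝ) / Real.sqrt (m + 1 : ℕ) ^ k) atTop
      (nhds (ballotPaths k 0)) := by
  obtain ⟨C, hC0, hC⟩ := starWalks_approx k 0
  have hsqrt : Tendsto (fun m : ℕ => Real.sqrt (m + 1 : ℕ)) atTop atTop :=
    Real.tendsto_sqrt_atTop.comp (tendsto_natCast_atTop_atTop.comp (tendsto_add_atTop_nat 1))
  rw [tendsto_iff_norm_sub_tendsto_zero]
  refine squeeze_zero (fun _ => norm_nonneg _) (fun m => ?_) (hsqrt.const_div_atTop C)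
  have hq0 : 0 < Real.sqrt (m + 1 : ℕ) := by linarith [one_le_sqrt_succ m]
  have h := hC m 1 .one
  set q := Real.sqrt (m + 1 : ℕ)
  rw [Real.norm_eq_abs, le_div_iff₀ hq0]
  refine le_of_mul_le_mul_right (le_trans (le_of_eq ?_) h) (pow_pos hq0 k)
  have hfac : starWalks m k 1 * q ^ (0 + 1) - ballotPaths k 0 * q ^ (k + 1) =
      (starWalks m k 1 / q ^ k - ballotPaths k 0) * (q * q ^ k) := by
    field_simp
    ring
  rw [hfac, abs_mul, abs_of_pos (mul_pos hq0 (pow_pos hq0 k)), mul_assoc]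

end Counting

section Semicircle

open Real

lemma ballotPaths_eq_integral (j r : ℕ) :
    (ballotPaths j r : ℝ) =
      2 / π * ∫ x in (0 : ℝ)..π, (2 * cos x) ^ j * (sin ((r + 1) * x) * sin x) := by
  induction j generalizing r with
  | zero =>
    have hcos : ∀ a : ℕ, (∫ x in (0 : ℝ)..π, cos ((a + 1) * x)) = 0 := by
      intro a
      have ha : (a + 1 : ℝ) ≠ 0 := by positivity
      rw [intervalIntegral.integral_comp_mul_left (fun x => cos x) ha, integral_cos]
      have := sin_nat_mul_pi (a + 1)
      push_cast at this
      simp [this]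
    have hprod : ∀ x : ℝ, (2 * cos x) ^ 0 * (sin ((r + 1) * x) * sin x) =
        (cos (r * x) - cos (((r + 1 : ℕ) + 1) * x)) / 2 := by
      intro x
      rw [show (r : ℝ) * x = (r + 1) * x - x by ring,
        show ((r + 1 : ℕ) + 1 : ℝ) * x = (r + 1) * x + x by push_cast; ring, cos_sub, cos_add]
      ring
    simp only [hprod]
    rw [intervalIntegral.integral_div, intervalIntegral.integral_sub
      (Continuous.intervalIntegrable (by fun_prop) _ _)
      (Continuous.intervalIntegrable (by fun_prop) _ _), hcos]
    cases r with
    | zero =>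
      simp [ballotPaths]
    | succ r =>
      push_cast
      rw [hcos]
      simp [ballotPaths]
  | succ j ih =>
    cases r with
    | zero =>
      rw [ballotPaths, ih 1]
      congr 2
      ext x
      rw [show ((1 : ℕ) + 1 : ℝ) * x = 2 * x by push_cast; ring,
        show ((0 : ℕ) + 1 : ℝ) * x = x by push_cast; ring, sin_two_mul]
      ring
    | succ r =>
      rw [ballotPaths, Nat.cast_add, ih (r + 2), ih r, ← mul_add, ← intervalIntegral.integral_add
        (Continuous.intervalIntegrable (by fun_prop) _ _)
        (Continuous.intervalIntegrable (by fun_prop) _ _)]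
      congr 2
      ext x
      rw [show ((r + 2 : ℕ) + 1 : ℝ) * x = ((r + 1 : ℕ) + 1) * x + x by push_cast; ring,
        show ((r : ℕ) + 1 : ℝ) * x = ((r + 1 : ℕ) + 1) * x - x by push_cast; ring,
        sin_add, sin_sub]
      ring

lemma integral_cos_pow_mul_sin_sq (k : ℕ) :
    (∫ x in (0 : ℝ)..π, cos x ^ k * sin x ^ 2) =
      (∫ x in (0 : ℝ)..π, cos x ^ k) / (k + 2) := by
  have h : ∀ x : ℝ, cos x ^ k * sin x ^ 2 = cos x ^ k - cos x ^ (k + 2) := by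
    intro x
    rw [sin_sq]
    ring
  simp only [h]
  rw [intervalIntegral.integral_sub (Continuous.intervalIntegrable (by fun_prop) _ _)
    (Continuous.intervalIntegrable (by fun_prop) _ _), integral_cos_pow]
  simp only [sin_pi, sin_zero]
  field_simp
  ring

lemma integral_cos_pow_even (p : ℕ) :
    (∫ x in (0 : ℝ)..π, cos x ^ (2 * p)) = π * p.centralBinom / 4 ^ p := by
  induction p with
  | zero => simp
  | succ p ih =>
    rw [mul_add, mul_one, integral_cos_pow, ih, sin_pi, sin_zero]
    have h : ((p + 1 : ℕ) : ℝ) * (p + 1).centralBinom = 2 * (2 * p + 1) * p.centralBinom := by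
      exact_mod_cast Nat.succ_mul_centralBinom_succ p
    have h' : ((p + 1).centralBinom : ℝ) = 2 * (2 * p + 1) * p.centralBinom / (p + 1) := by
      rw [eq_div_iff (by positivity), ← h]
      push_cast
      ring
    rw [h']
    push_cast
    field_simp
    ring

lemma integral_cos_pow_odd (p : ℕ) : (∫ x in (0 : ℝ)..π, cos x ^ (2 * p + 1)) = 0 := by
  induction p with
  | zero => simp
  | succ p ih =>
    rw [show 2 * (p + 1) + 1 = (2 * p + 1) + 2 by ring, integral_cos_pow, ih, sin_pi, sin_zero]
    simp

lemma cast_Cat (p : ℕ) : (Cat p : ℝ) = p.centralBinom / (p + 1) := by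
  have h : Cat p = p.centralBinom / (p + 1) := by
    rw [Cat, Nat.centralBinom_eq_two_mul_choose, Nat.choose_eq_factorial_div_factorial (by omega),
      Nat.div_div_eq_div_mul, Nat.factorial_succ, show 2 * p - p = p by omega]
    congr 1
    ring
  rw [h, Nat.cast_div (Nat.succ_dvd_centralBinom p) (by positivity)]
  push_cast
  rfl

lemma two_div_pi_mul_integral_cos_pow_mul_sin_sq (k : ℕ) :
    2 / π * (∫ x in (0 : ℝ)..π, cos x ^ k * sin x ^ 2) =
      if Even k then (Cat (k / 2) : ℝ) / 4 ^ (k / 2) else 0 := by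
  rw [integral_cos_pow_mul_sin_sq]
  obtain ⟨p, rfl | rfl⟩ := Nat.even_or_odd' k
  · rw [if_pos (even_two_mul p), Nat.mul_div_cancel_left p two_pos, integral_cos_pow_even, cast_Cat]
    push_cast
    field_simp
  · rw [if_neg (Nat.not_even_two_mul_add_one p), integral_cos_pow_odd]
    simp

lemma integral_pow_mul_sqrt_one_sub_sq (k : ℕ) :
    (∫ α in (-1 : ℝ)..1, α ^ k * √(1 - α ^ 2)) = ∫ x in (0 : ℝ)..π, cos x ^ k * sin x ^ 2 := by
  have h := intervalIntegral.integral_comp_mul_deriv (a := 0) (b := π) (f := cos)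
    (f' := fun x => -sin x) (g := fun α : ℝ => α ^ k * √(1 - α ^ 2))
    (fun x _ => hasDerivAt_cos x) (by fun_prop) (by fun_prop)
  rw [cos_zero, cos_pi] at h
  rw [intervalIntegral.integral_symm, ← h, ← intervalIntegral.integral_neg]
  refine intervalIntegral.integral_congr fun x hx => ?_
  rw [Set.uIcc_of_le pi_pos.le] at hx
  have hsin : √(1 - cos x ^ 2) = sin x := by
    rw [← sin_sq, sqrt_sq (sin_nonneg_of_mem_Icc hx)]
  simp only [Function.comp_apply, hsin]
  ring

lemma ballotPaths_div_two_pow (k : ℕ) :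
    (ballotPaths k 0 : ℝ) / 2 ^ k = if Even k then (Cat (k / 2) : ℝ) / 4 ^ (k / 2) else 0 := by
  rw [← two_div_pi_mul_integral_cos_pow_mul_sin_sq, ballotPaths_eq_integral, mul_div_assoc,
    ← intervalIntegral.integral_div]
  congr 2
  ext x
  rw [mul_pow, Nat.cast_zero, zero_add, one_mul]
  field_simp

end Semicircle

/-- As `n → ∞`, the `k`-th moment `(1/n!) · Σ_{l ∈ ℤ} mul_n(l) · (l/(2√n))^k` of the
rescaled spectral measure of `G_n` converges to `0` for `k` odd and to `Cat(p)/4^p` for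
`k = 2p` even; these limits are exactly the moments `(2/π) ∫_{−1}^{1} α^k √(1−α²) dα`
of the semicircle distribution. -/
theorem cayley_spectral_moments (k : ℕ) :
    Tendsto (fun n : ℕ =>
        (1 / (n.factorial : ℝ)) *
          ∑' l : ℤ, (muln n l : ℝ) * ((l : ℝ) / (2 * Real.sqrt n)) ^ k)
      atTop (nhds (if Even k then (Cat (k / 2) : ℝ) / 4 ^ (k / 2) else 0)) ∧
    (2 / Real.pi) * (∫ α in (-1 : ℝ)..1, α ^ k * Real.sqrt (1 - α ^ 2)) =
      (if Even k then (Cat (k / 2) : ℝ) / 4 ^ (k / 2) else 0) := by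
  refine ⟨?_, ?_⟩
  · rw [← ballotPaths_div_two_pow, ← tendsto_add_atTop_iff_nat 1]
    simp only [moment_eq]
    exact (tendsto_starWalks k).div_const _
  · rw [integral_pow_mul_sqrt_one_sub_sq, two_div_pi_mul_integral_cos_pow_mul_sin_sq]
end

section
/- For n ≥ 2, let mul_n(l) denote the multiplicity of l ∈ ℤ as an eigenvalue of the adjacency matrix of the Cayley graph G_n of 𝔖_n generated by (1 i), 2 ≤ i ≤ n. Then for all real numbers a < b, (1/n!) · Σ_{l ∈ ℤ, 2a√n ≤ l ≤ 2b√n} mul_n(l) converges, as n → ∞, to (2/π) ∫_a^b √(max(1−α², 0)) dα; that is, the empirical spectral measure of G_n rescaled by 1/(2√n) converges in distribution to the semicircle law. -/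
open Equiv Polynomial Filter

section Words

variable {β : Type*} [DecidableEq β]

theorem List.exists_nodup_between_of_not_nodup {w : List β} (hw : ¬ w.Nodup) :
    ∃ a p u b, w = a ++ p :: (u ++ p :: b) ∧ u.Nodup := by
  induction w with
  | nil => simp at hw
  | cons h t ih =>
    by_cases ht : t.Nodup
    · have hh : h ∈ t := by
        by_contra hc
        exact hw (List.nodup_cons.2 ⟨hc, ht⟩)
      obtain ⟨u, b, rfl⟩ := List.append_of_mem hh
      exact ⟨[], h, u, b, rfl, ht.of_append_left⟩
    · obtain ⟨a, p, u, b, rfl, hu⟩ := ih ht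
      exact ⟨h :: a, p, u, b, rfl, hu⟩

/-- The product of the star transpositions `(x i)`, for `i` running through a word. -/
def starProd (x : β) (w : List β) : Perm β := (w.map (swap x)).prod

theorem starProd_append (x : β) (a b : List β) :
    starProd x (a ++ b) = starProd x a * starProd x b := by
  simp [starProd]

theorem starProd_cons (x p : β) (b : List β) :
    starProd x (p :: b) = swap x p * starProd x b := by
  simp [starProd]

theorem starProd_apply_of_notMem {x p : β} (hp : p ≠ x) {w : List β} (hw : p ∉ w) :
    starProd x w p = p := by
  induction w with
  | nil => simp [starProd]
  | cons h t ih =>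
    simp only [List.mem_cons, not_or] at hw
    rw [starProd_cons, Perm.mul_apply, ih hw.2, swap_apply_of_ne_of_ne hp hw.1]

theorem starProd_apply_eq_iff_of_notMem {x p : β} (hp : p ≠ x) {w : List β} (hw : p ∉ w) {z : β} :
    starProd x w z = p ↔ z = p := by
  conv_lhs => rhs; rw [← starProd_apply_of_notMem hp hw]
  exact (starProd x w).injective.eq_iff

theorem count_ne_one_of_starProd_eq_one {x p : β} (hp : p ≠ x) {w : List β}
    (hw : starProd x w = 1) : w.count p ≠ 1 := by
  intro hc
  have hm : p ∈ w := List.count_pos_iff.1 (by omega)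
  obtain ⟨a, b, rfl⟩ := List.append_of_mem hm
  simp only [List.count_append, List.count_cons_self] at hc
  have ha : p ∉ a := List.count_eq_zero.1 (by omega)
  have hb : p ∉ b := List.count_eq_zero.1 (by omega)
  have h := congrArg (fun g : Perm β => g p) hw
  simp only [starProd_append, starProd_cons, Perm.mul_apply, Perm.one_apply,
    starProd_apply_of_notMem hp hb, swap_apply_right,
    starProd_apply_eq_iff_of_notMem hp ha] at h
  exact hp h.symm

theorem exists_two_lt_count_of_starProd_eq_one {x : β} {w : List β} (hx : x ∉ w) (hne : w ≠ [])
    (hchain : w.IsChain (· ≠ ·)) (hw : starProd x w = 1) : ∃ p ∈ w, 2 < w.count p := by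
  have hnd : ¬ w.Nodup := by
    intro hnd
    obtain ⟨p, hp⟩ := List.exists_mem_of_ne_nil w hne
    exact count_ne_one_of_starProd_eq_one (ne_of_mem_of_not_mem hp hx) hw
      (List.count_eq_one_of_mem hnd hp)
  obtain ⟨a, p, u, b, rfl, hu⟩ := List.exists_nodup_between_of_not_nodup hnd
  refine ⟨p, by simp, ?_⟩
  by_contra! hc
  simp only [List.count_append, List.count_cons_self] at hc
  have ha : p ∉ a := List.count_eq_zero.1 (by omega)
  have hb : p ∉ b := List.count_eq_zero.1 (by omega)
  have hpx : p ≠ x := fun h => hx (by simp [h])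
  have h := congrArg (fun g : Perm β => g p) hw
  simp only [starProd_append, starProd_cons, Perm.mul_apply, Perm.one_apply,
    starProd_apply_of_notMem hpx hb, swap_apply_right,
    starProd_apply_eq_iff_of_notMem hpx ha] at h
  have hux : starProd x u x = x := by
    rw [swap_apply_eq_iff, swap_apply_right] at h
    exact h
  rcases List.eq_nil_or_concat' u with rfl | ⟨v, q, rfl⟩
  · have := (List.isChain_append.1 hchain).2.1
    simp at this
  · have hqv : q ∉ v := by
      have := List.nodup_append.1 hu
      intro hq
      exact this.2.2 q hq q (by simp) rfl
    have hqx : q ≠ x := fun h => hx (by simp [h])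
    rw [starProd_append, starProd_cons] at hux
    simp only [starProd, List.map_nil, List.prod_nil, mul_one, Perm.mul_apply,
      swap_apply_left] at hux
    exact hqx ((starProd_apply_of_notMem hqx hqv).symm.trans hux)

theorem two_mul_card_toFinset_lt_length {x : β} {w : List β} (hx : x ∉ w) (hne : w ≠ [])
    (hchain : w.IsChain (· ≠ ·)) (hw : starProd x w = 1) :
    2 * w.toFinset.card < w.length := by
  obtain ⟨p, hp, hp2⟩ := exists_two_lt_count_of_starProd_eq_one hx hne hchain hw
  have h1 : ∑ q ∈ w.toFinset, w.count q = w.length := List.sum_toFinset_count_eq_length w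
  have h2 : ∑ _q ∈ w.toFinset, 2 < ∑ q ∈ w.toFinset, w.count q := by
    refine Finset.sum_lt_sum (fun q hq => ?_) ⟨p, by simpa using hp, hp2⟩
    rw [List.mem_toFinset] at hq
    have h3 := count_ne_one_of_starProd_eq_one (ne_of_mem_of_not_mem hq hx) hw
    have h4 := List.count_pos_iff.2 hq
    omega
  rw [h1, Finset.sum_const, smul_eq_mul] at h2
  omega

/-- Lists of given length over `S` with few distinct letters are few. -/
theorem card_le_of_card_toFinset_le (S : Finset β) (L : Finset (List β)) (d s : ℕ)
    (hL : ∀ w ∈ L, w.length = d + 1 ∧ (∀ i ∈ w, i ∈ S) ∧ w.toFinset.card ≤ s) :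
    L.card ≤ s ^ (d + 1) * S.card ^ s := by
  classical
  have key : L ⊆ (Finset.univ : Finset ((Fin (d + 1) → Fin s) × (Fin s → S))).image
      (fun fg => List.ofFn (fun j => (fg.2 (fg.1 j) : β))) := by
    intro w hw
    obtain ⟨h1, h2, h3⟩ := hL w hw
    have hpos : 0 < w.length := by omega
    let i₀ : w.toFinset := ⟨w[0], by simp⟩
    have : Nonempty w.toFinset := ⟨i₀⟩
    obtain ⟨e⟩ : Nonempty (w.toFinset ↪ Fin s) :=
      Function.Embedding.nonempty_of_card_le (by simpa only [Fintype.card_coe, Fintype.card_fin] using h3)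
    rw [Finset.mem_image]
    let f : Fin (d + 1) → w.toFinset := fun j => ⟨w[j.1]'(by omega), by simp⟩
    let g : Fin s → w.toFinset := Function.invFun e
    refine ⟨(fun j => e (f j), fun t => ⟨g t, h2 _ (List.mem_toFinset.1 (g t).2)⟩), by simp, ?_⟩
    apply List.ext_getElem
    · simp [h1]
    · intro j h4 h5
      have : g (e (f ⟨j, by omega⟩)) = f ⟨j, by omega⟩ := Function.leftInverse_invFun e.injective _
      rw [List.getElem_ofFn]
      exact congrArg Subtype.val this
  calc L.card ≤ _ := Finset.card_le_card key
    _ ≤ _ := Finset.card_image_le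
    _ = _ := by simp

/-- Words of length `d + 1` over `S` starting with `i`, without equal consecutive letters. -/
def reducedWords (S : Finset β) : ℕ → β → Finset (List β)
  | 0, i => {[i]}
  | d + 1, i => ((S.erase i).biUnion (reducedWords S d)).image (List.cons i)

theorem of_mem_reducedWords {S : Finset β} {d : ℕ} {i : β} (hi : i ∈ S) {w : List β}
    (hw : w ∈ reducedWords S d i) :
    w.length = d + 1 ∧ (∀ j ∈ w, j ∈ S) ∧ w.IsChain (· ≠ ·) ∧ w.head? = some i := by
  induction d generalizing i w with
  | zero =>
    simp only [reducedWords, Finset.mem_singleton] at hw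
    subst hw
    simp [hi]
  | succ d ih =>
    simp only [reducedWords, Finset.mem_image, Finset.mem_biUnion, Finset.mem_erase] at hw
    obtain ⟨v, ⟨j, ⟨hj, hjS⟩, hv⟩, rfl⟩ := hw
    obtain ⟨h1, h2, h3, h4⟩ := ih hjS hv
    refine ⟨by simp [h1], by simpa [hi] using h2, ?_, by simp⟩
    rw [List.isChain_cons]
    refine ⟨fun y hy => ?_, h3⟩
    rw [h4] at hy
    simp at hy
    rw [← hy]
    exact hj.symm

theorem pairwiseDisjoint_reducedWords (S : Finset β) (d : ℕ) :
    (S : Set β).PairwiseDisjoint (reducedWords S d) := by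
  intro i hi j hj hij
  refine Finset.disjoint_left.2 fun w h1 h2 => hij ?_
  have := (of_mem_reducedWords hi h1).2.2.2.symm.trans (of_mem_reducedWords hj h2).2.2.2
  simpa using this

variable {R : Type*} [Ring R]

/-- The sum of all products `f i₁ * ⋯ * f i_d` over words in `S` of length `d` without equal
consecutive letters. -/
def reducedSum (f : β → R) (S : Finset β) : ℕ → R
  | 0 => 1
  | d + 1 => ∑ i ∈ S, ∑ w ∈ reducedWords S d i, (w.map f).prod

theorem sum_reducedWords_succ (f : β → R) {S : Finset β} {d : ℕ} (i : β) (hi : i ∈ S) :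
    ∑ w ∈ reducedWords S (d + 1) i, (w.map f).prod =
      f i * (reducedSum f S (d + 1) - ∑ w ∈ reducedWords S d i, (w.map f).prod) := by
  rw [reducedWords, Finset.sum_image (by simp),
    Finset.sum_biUnion ((pairwiseDisjoint_reducedWords S d).subset (by simp)), reducedSum,
    ← Finset.sum_erase_eq_sub hi]
  simp [Finset.mul_sum]

theorem sum_mul_reducedSum_one (f : β → R) (S : Finset β) (hf : ∀ i ∈ S, f i * f i = 1) :
    (∑ i ∈ S, f i) * reducedSum f S 1 = reducedSum f S 2 + (S.card : R) := by
  rw [reducedSum.eq_2 f S 1, Finset.sum_congr rfl (sum_reducedWords_succ f)]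
  simp only [mul_sub, Finset.sum_sub_distrib, ← Finset.sum_mul]
  simp [reducedWords, Finset.sum_congr rfl hf]

theorem sum_mul_reducedSum_add_two (f : β → R) (S : Finset β) (hf : ∀ i ∈ S, f i * f i = 1)
    (d : ℕ) :
    (∑ i ∈ S, f i) * reducedSum f S (d + 2) =
      reducedSum f S (d + 3) + ((S.card : R) - 1) * reducedSum f S (d + 1) := by
  rw [reducedSum.eq_2 f S (d + 2), Finset.sum_congr rfl (sum_reducedWords_succ f)]
  simp only [mul_sub, Finset.sum_sub_distrib, ← Finset.sum_mul]
  have : ∑ i ∈ S, f i * ∑ w ∈ reducedWords S (d + 1) i, (w.map f).prod =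
      ((S.card : R) - 1) * reducedSum f S (d + 1) := by
    rw [Finset.sum_congr rfl fun i hi => by
      rw [sum_reducedWords_succ f i hi, ← mul_assoc, hf i hi, one_mul]]
    rw [Finset.sum_sub_distrib]
    simp [sub_mul, reducedSum]
  rw [this]
  abel

theorem sum_mul_reducedSum_zero (f : β → R) (S : Finset β) :
    (∑ i ∈ S, f i) * reducedSum f S 0 = reducedSum f S 1 := by
  simp [reducedSum, reducedWords]

/-- The reduced words in the letters of `S` whose star product is trivial. -/
def trivialReducedWords [Fintype β] (x : β) (S : Finset β) (d : ℕ) : Finset (List β) :=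
  (S.biUnion (reducedWords S d)).filter fun w => starProd x w = 1

theorem card_trivialReducedWords_le [Fintype β] {x : β} {S : Finset β} (hx : x ∉ S) (d : ℕ) :
    (trivialReducedWords x S d).card ≤ (d / 2) ^ (d + 1) * S.card ^ (d / 2) := by
  refine card_le_of_card_toFinset_le S _ d _ fun w hw => ?_
  simp only [trivialReducedWords, Finset.mem_filter, Finset.mem_biUnion] at hw
  obtain ⟨⟨i, hi, hw⟩, h1⟩ := hw
  obtain ⟨h2, h3, h4, -⟩ := of_mem_reducedWords hi hw
  refine ⟨h2, h3, ?_⟩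
  have := two_mul_card_toFinset_lt_length (fun h => hx (h3 x h))
    (List.ne_nil_of_length_pos (by omega)) h4 h1
  omega

end Words

theorem swap_sum_commute {β V : Type*} [DecidableEq β] [AddCommGroup V] [Module ℂ V]
    (ρ : Perm β →* Module.End ℂ V) {x y i : β} {S : Finset β} (hx : x ∉ S) (hy : y ∈ S)
    (hi : i ∈ S) : Commute (∑ j ∈ S, ρ (swap x j)) (ρ (swap y i)) := by
  have hyx : x ≠ y := fun h => hx (h ▸ hy)
  have hix : x ≠ i := fun h => hx (h ▸ hi)
  rw [Commute, SemiconjBy, Finset.sum_mul, Finset.mul_sum]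
  have hS : ∀ j ∈ S, swap y i j ∈ S := by
    intro j hj
    rw [swap_apply_def]
    split_ifs <;> assumption
  refine Finset.sum_bij' (fun j _ => swap y i j) (fun j _ => swap y i j) hS hS
    (by simp) (by simp) fun j hj => ?_
  rw [← map_mul, ← map_mul]
  congr 1
  have := Equiv.swap_apply_apply (swap y i) x j
  rw [swap_apply_of_ne_of_ne hyx hix] at this
  rw [this]
  simp [mul_assoc]

/-- Integrality of the spectrum of star transpositions (Jucys-Murphy elements) in any
finite-dimensional complex representation of the symmetric group. -/
theorem exists_int_of_hasEigenvalue_sum_swap {β V : Type*} [DecidableEq β] [AddCommGroup V]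
    [Module ℂ V] [FiniteDimensional ℂ V] (ρ : Perm β →* Module.End ℂ V) (S : Finset β) (x : β)
    (hx : x ∉ S) (μ : ℂ) (hμ : (∑ j ∈ S, ρ (swap x j)).HasEigenvalue μ) :
    ∃ z : ℤ, μ = z := by
  induction S using Finset.induction_on generalizing x μ with
  | empty =>
    obtain ⟨v, hv⟩ := hμ.exists_hasEigenvector
    have := hv.apply_eq_smul
    simp only [Finset.sum_empty, LinearMap.zero_apply] at this
    refine ⟨0, ?_⟩
    simpa using (smul_eq_zero.1 this.symm).resolve_right hv.2
  | insert y T hy ih =>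
    set X := ∑ j ∈ insert y T, ρ (swap x j) with hX
    set Y := ∑ j ∈ T, ρ (swap y j) with hY
    set s := ρ (swap x y) with hs
    have hss : s * s = 1 := by rw [hs, ← map_mul, swap_mul_self, map_one]
    have hcomm : Commute X Y := Commute.sum_right _ _ _ fun i hi =>
      swap_sum_commute ρ hx (Finset.mem_insert_self _ _) (Finset.mem_insert_of_mem hi)
    have hsX : s * X = Y * s + 1 := by
      rw [hX, Finset.sum_insert hy, mul_add, hss, add_comm, hY, Finset.mul_sum, Finset.sum_mul]
      congr 1
      refine Finset.sum_congr rfl fun i hi => ?_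
      rw [hs, ← map_mul, ← map_mul]
      congr 1
      have := Equiv.swap_apply_apply (swap x y) x i
      rw [swap_apply_left, swap_apply_of_ne_of_ne (ne_of_mem_of_not_mem
        (Finset.mem_insert_of_mem hi) hx) (ne_of_mem_of_not_mem hi hy)] at this
      rw [this]
      simp [mul_assoc]
    obtain ⟨a, v, hv0, hXv, hYv⟩ : ∃ (a : ℂ) (v : V), v ≠ 0 ∧ X v = μ • v ∧ Y v = a • v := by
      have hmap : ∀ v ∈ X.eigenspace μ, Y v ∈ X.eigenspace μ := by
        intro v hv
        rw [Module.End.mem_eigenspace_iff] at hv ⊢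
        have := congrArg (fun f : Module.End ℂ V => f v) hcomm.eq
        simp only [Module.End.mul_apply] at this
        rw [this, hv, map_smul]
      have : Nontrivial (X.eigenspace μ) := Submodule.nontrivial_iff_ne_bot.2 hμ
      obtain ⟨a, ha⟩ := Module.End.exists_eigenvalue (Y.restrict hmap)
      obtain ⟨v, hv⟩ := ha.exists_hasEigenvector
      refine ⟨a, v, by simpa using hv.2, Module.End.mem_eigenspace_iff.1 v.2, ?_⟩
      exact congrArg Subtype.val hv.apply_eq_smul
    obtain ⟨z, hz⟩ := ih y hy a
      (Module.End.hasEigenvalue_of_hasEigenvector ⟨Module.End.mem_eigenspace_iff.2 hYv, hv0⟩)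
    have hYs : Y (s v) = μ • s v - v := by
      have := congrArg (fun f : Module.End ℂ V => f v) hsX
      simp only [Module.End.mul_apply, LinearMap.add_apply, Module.End.one_apply, hXv,
        map_smul] at this
      rw [this]; abel
    have hssv : s (s v) = v := congrArg (fun f : Module.End ℂ V => f v) hss
    by_cases hw : (μ - a) • s v - v = 0
    · have h1 : (μ - a) • s v = v := sub_eq_zero.1 hw
      have h2 : (μ - a) • v = s v := by
        conv_rhs => rw [← h1]
        rw [map_smul, hssv]
      have h3 : ((μ - a) * (μ - a) - 1) • v = 0 := by
        rw [sub_smul, mul_smul, h2, h1, one_smul, sub_self]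
      have h4 : (μ - a) * (μ - a) = 1 :=
        sub_eq_zero.1 ((smul_eq_zero.1 h3).resolve_right hv0)
      rcases mul_self_eq_one_iff.1 h4 with h | h
      · exact ⟨z + 1, by push_cast; rw [← hz, ← h]; ring⟩
      · exact ⟨z - 1, by push_cast; rw [← hz]; linear_combination h⟩
    · refine ih y hy μ
        (Module.End.hasEigenvalue_of_hasEigenvector ⟨Module.End.mem_eigenspace_iff.2 ?_, hw⟩)
      rw [map_sub, map_smul, hYs, hYv]
      module

section Matrices

/-- The left regular representation of a finite group by permutation matrices. -/
def leftRegularMatrix (G : Type*) [Group G] [Fintype G] [DecidableEq G] : G →* Matrix G G ℂ where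
  toFun g := Matrix.of fun σ τ => if g * τ = σ then 1 else 0
  map_one' := by
    ext σ τ
    simp [Matrix.one_apply, eq_comm]
  map_mul' g h := by
    ext σ τ
    simp [Matrix.mul_apply, mul_assoc]

theorem trace_leftRegularMatrix {G : Type*} [Group G] [Fintype G] [DecidableEq G] (g : G) :
    (leftRegularMatrix G g).trace = if g = 1 then (Fintype.card G : ℂ) else 0 := by
  simp only [Matrix.trace, Matrix.diag, leftRegularMatrix, MonoidHom.coe_mk, OneHom.coe_mk,
    Matrix.of_apply, mul_eq_right]
  split_ifs <;> simp

theorem adjMatn_succ (m : ℕ) : adjMatn (m + 1) =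
    ∑ i ∈ Finset.univ.erase (0 : Fin (m + 1)), leftRegularMatrix _ (swap 0 i) := by
  ext σ τ
  have h : ∀ i : Fin (m + 1), swap 0 i * τ = σ ↔ τ * σ⁻¹ = swap 0 i := by
    intro i
    rw [mul_inv_eq_iff_eq_mul]
    constructor
    · rintro rfl
      simp
    · rintro rfl
      simp
  simp only [adjMatn, Matrix.sum_apply, leftRegularMatrix, MonoidHom.coe_mk, OneHom.coe_mk,
    Matrix.of_apply, h]
  split_ifs with hex
  · obtain ⟨i, hi, hi'⟩ := hex
    rw [Finset.sum_eq_single_of_mem i (by simpa using hi), if_pos hi']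
    intro j _ hji
    refine if_neg fun hj => hji ?_
    have := congrArg (fun g : Perm (Fin (m + 1)) => g 0) (hj.symm.trans hi')
    simpa using this
  · refine (Finset.sum_eq_zero fun i hi => if_neg fun hi' => hex ⟨i, by simpa using hi, hi'⟩).symm

theorem isHermitian_adjMatn (m : ℕ) : (adjMatn (m + 1)).IsHermitian := by
  ext σ τ
  have h : ∀ i : Fin (m + 1), σ * τ⁻¹ = swap 0 i ↔ τ * σ⁻¹ = swap 0 i := by
    intro i
    rw [← inv_inj, mul_inv_rev, inv_inv, swap_inv]
  rw [Matrix.conjTranspose_apply]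
  simp [adjMatn, h, apply_ite]

theorem exists_int_eigenvalues_adjMatn (m : ℕ) (σ : Perm (Fin (m + 1))) :
    ∃ z : ℤ, (isHermitian_adjMatn m).eigenvalues σ = z := by
  have hA := isHermitian_adjMatn m
  let ρ : Perm (Fin (m + 1)) →* Module.End ℂ (Perm (Fin (m + 1)) → ℂ) :=
    (Matrix.toLinAlgEquiv' : Matrix _ _ ℂ ≃ₐ[ℂ] _).toAlgHom.toMonoidHom.comp
      (leftRegularMatrix (Perm (Fin (m + 1))))
  have hρ : ∑ i ∈ Finset.univ.erase (0 : Fin (m + 1)), ρ (swap 0 i) =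
      Matrix.toLinAlgEquiv' (adjMatn (m + 1)) := by
    rw [adjMatn_succ, map_sum]
    rfl
  obtain ⟨z, hz⟩ := exists_int_of_hasEigenvalue_sum_swap ρ (Finset.univ.erase (0 : Fin (m + 1)))
    0 (by simp) (hA.eigenvalues σ) (by
      rw [hρ]
      refine Module.End.hasEigenvalue_of_hasEigenvector
        (x := (hA.eigenvectorBasis σ : Perm (Fin (m + 1)) → ℂ))
        ⟨Module.End.mem_eigenspace_iff.2 ?_, ?_⟩
      · rw [Matrix.toLinAlgEquiv'_apply, hA.mulVec_eigenvectorBasis]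
        rfl
      · intro h
        exact hA.eigenvectorBasis.orthonormal.ne_zero σ (by ext i; exact congrFun h i))
  exact ⟨z, by exact_mod_cast hz⟩

theorem trace_pow_adjMatn (m k : ℕ) : (adjMatn (m + 1) ^ k).trace =
    ((∑ σ, (isHermitian_adjMatn m).eigenvalues σ ^ k : ℝ) : ℂ) := by
  have hA := isHermitian_adjMatn m
  conv_lhs => rw [hA.spectral_theorem, ← map_pow]
  rw [Unitary.conjStarAlgAut_apply, Matrix.trace_mul_cycle, Unitary.coe_star_mul_self, one_mul,
    Matrix.diagonal_pow, Matrix.trace_diagonal]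
  simp

theorem sum_muln (m : ℕ) (x y : ℤ) : ∑ l ∈ Finset.Icc x y, muln (m + 1) l =
    (Finset.univ.filter fun σ => (isHermitian_adjMatn m).eigenvalues σ ∈
      Set.Icc (x : ℝ) y).card := by
  classical
  choose z hz using exists_int_eigenvalues_adjMatn m
  have h1 : ∀ l : ℤ, muln (m + 1) l = (Finset.univ.filter fun σ => z σ = l).card := by
    intro l
    rw [muln, (isHermitian_adjMatn m).roots_charpoly_eq_eigenvalues, Multiset.count_map,
      ← Finset.filter_val, Finset.card_val]
    congr 1
    ext σ
    simp only [Finset.mem_filter, Finset.mem_univ, true_and, Function.comp_apply, hz]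
    rw [eq_comm]
    norm_cast
  have h2 : (Finset.univ.filter fun σ => (isHermitian_adjMatn m).eigenvalues σ ∈
      Set.Icc (x : ℝ) y) = Finset.univ.filter fun σ => z σ ∈ Finset.Icc x y := by
    ext σ
    simp [hz]
  rw [h2, Finset.card_eq_sum_card_fiberwise (f := z) (t := Finset.Icc x y)
    (by intro σ; simp)]
  refine Finset.sum_congr rfl fun l hl => ?_
  rw [h1]
  congr 1
  ext σ
  simp only [Finset.mem_filter, Finset.mem_univ, true_and]
  exact ⟨fun h => ⟨h ▸ hl, h⟩, fun h => h.2⟩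

end Matrices

section Moments

open MeasureTheory Topology

theorem abs_eval_le_mul_pow (p : ℝ[X]) {y : ℝ} (hy : 1 ≤ |y|) :
    |p.eval y| ≤ (∑ i ∈ Finset.range (p.natDegree + 1), |p.coeff i|) * |y| ^ p.natDegree := by
  rw [eval_eq_sum_range, Finset.sum_mul]
  refine (Finset.abs_sum_le_sum_abs _ _).trans (Finset.sum_le_sum fun i hi => ?_)
  rw [abs_mul, abs_pow]
  have : i ≤ p.natDegree := by simpa [Nat.lt_succ_iff] using hi
  gcongr

/-- A bounded continuous function is approximated by a polynomial, with an error that is small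
on `[-2, 2]` and grows polynomially. -/
theorem exists_polynomial_near_add_pow (f : BoundedContinuousFunction ℝ ℝ) {ε : ℝ} (hε : 0 < ε) :
    ∃ (p : ℝ[X]) (k : ℕ), ∀ y : ℝ, |p.eval y - f y| ≤ ε + ε * y ^ (2 * k) := by
  obtain ⟨p, hp⟩ := exists_polynomial_near_of_continuousOn (-2) 2 f f.continuous.continuousOn ε hε
  set D := p.natDegree
  set C := ∑ i ∈ Finset.range (p.natDegree + 1), |p.coeff i| with hC
  have hC0 : 0 ≤ C := Finset.sum_nonneg fun _ _ => abs_nonneg _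
  obtain ⟨j, hj⟩ := exists_pow_lt_of_lt_one (x := ε / (C + ‖f‖ + 1)) (by positivity)
    (show (1 / 4 : ℝ) < 1 by norm_num)
  refine ⟨p, D + j, fun y => ?_⟩
  have hy0 : 0 ≤ y ^ (2 * (D + j)) := by rw [pow_mul]; positivity
  by_cases hy : |y| ≤ 2
  · have := hp y ⟨(abs_le.1 hy).1, (abs_le.1 hy).2⟩
    nlinarith
  · push Not at hy
    have h1 : |y| ^ D * 4 ^ j ≤ y ^ (2 * (D + j)) := by
      have : y ^ (2 * (D + j)) = |y| ^ D * (|y| ^ D * (|y| ^ 2) ^ j) := by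
        rw [← (even_two_mul (D + j)).pow_abs]; ring
      rw [this]
      have h4 : (4 : ℝ) ≤ |y| ^ 2 := by nlinarith
      have h5 : 1 ≤ |y| ^ D := one_le_pow₀ (by linarith)
      have h6 : (4 : ℝ) ^ j ≤ (|y| ^ 2) ^ j := by gcongr
      have h7 : (0 : ℝ) ≤ 4 ^ j := by positivity
      gcongr
      nlinarith
    have h2 := abs_eval_le_mul_pow p (y := y) (by linarith)
    have h3 : |f y| ≤ ‖f‖ := f.norm_coe_le_norm y
    have h5 : 1 ≤ |y| ^ D := one_le_pow₀ (by linarith)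
    have h6 : (C + ‖f‖ + 1) ≤ ε * 4 ^ j := by
      rw [lt_div_iff₀ (by positivity), one_div, inv_pow, inv_mul_lt_iff₀ (by positivity)] at hj
      linarith
    have h7 : (0 : ℝ) ≤ ‖f‖ := norm_nonneg f
    calc |p.eval y - f y| ≤ |p.eval y| + |f y| := abs_sub _ _
      _ ≤ C * |y| ^ D + ‖f‖ * |y| ^ D := by nlinarith
      _ ≤ (C + ‖f‖ + 1) * |y| ^ D := by nlinarith
      _ ≤ (ε * 4 ^ j) * |y| ^ D := by gcongr
      _ = ε * (|y| ^ D * 4 ^ j) := by ring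
      _ ≤ ε * y ^ (2 * (D + j)) := by gcongr
      _ ≤ _ := by linarith

theorem abs_integral_eval_sub_le (μ : ProbabilityMeasure ℝ)
    (hμ : ∀ k : ℕ, Integrable (fun y : ℝ => y ^ k) (μ : Measure ℝ))
    (f : BoundedContinuousFunction ℝ ℝ) {ε : ℝ} {p : ℝ[X]} {k : ℕ}
    (h : ∀ y : ℝ, |p.eval y - f y| ≤ ε + ε * y ^ (2 * k)) :
    |∫ y, p.eval y ∂(μ : Measure ℝ) - ∫ y, f y ∂(μ : Measure ℝ)| ≤
      ε + ε * ∫ y, y ^ (2 * k) ∂(μ : Measure ℝ) := by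
  have hp : Integrable (fun y : ℝ => p.eval y) (μ : Measure ℝ) := by
    simp only [eval_eq_sum_range]
    exact integrable_finsetSum _ fun i _ => (hμ i).const_mul _
  rw [← integral_sub hp (f.integrable _)]
  have h2 : ∫ y, (ε + ε * y ^ (2 * k)) ∂(μ : Measure ℝ) =
      ε + ε * ∫ y, y ^ (2 * k) ∂(μ : Measure ℝ) := by
    rw [integral_add (integrable_const _) ((hμ _).const_mul _), integral_const_mul]
    simp
  rw [← h2, ← Real.norm_eq_abs]
  exact norm_integral_le_of_norm_le ((integrable_const _).add ((hμ _).const_mul _))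
    (Eventually.of_forall h)

/-- The method of moments, for a limit whose even moments are at most `1` (as is the case when it
is supported on `[-1, 1]`). -/
theorem tendsto_of_tendsto_moments {ν : ℕ → ProbabilityMeasure ℝ} {μ : ProbabilityMeasure ℝ}
    (hν : ∀ n k : ℕ, Integrable (fun y : ℝ => y ^ k) (ν n : Measure ℝ))
    (hμ : ∀ k : ℕ, Integrable (fun y : ℝ => y ^ k) (μ : Measure ℝ))
    (hμ1 : ∀ k : ℕ, ∫ y, y ^ (2 * k) ∂(μ : Measure ℝ) ≤ 1)
    (h : ∀ k : ℕ, Tendsto (fun n => ∫ y, y ^ k ∂(ν n : Measure ℝ)) atTop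
      (𝓝 (∫ y, y ^ k ∂(μ : Measure ℝ)))) :
    Tendsto ν atTop (𝓝 μ) := by
  have heval : ∀ (ξ : ProbabilityMeasure ℝ)
      (_ : ∀ k : ℕ, Integrable (fun y : ℝ => y ^ k) (ξ : Measure ℝ)) (p : ℝ[X]),
      ∫ y, p.eval y ∂(ξ : Measure ℝ) =
        ∑ i ∈ Finset.range (p.natDegree + 1), p.coeff i * ∫ y, y ^ i ∂(ξ : Measure ℝ) := by
    intro ξ hξ p
    simp only [eval_eq_sum_range]
    rw [integral_finsetSum _ fun i _ => (hξ i).const_mul _]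
    simp only [integral_const_mul]
  rw [ProbabilityMeasure.tendsto_iff_forall_integral_tendsto]
  intro f
  rw [Metric.tendsto_nhds]
  intro ε hε
  obtain ⟨p, k, hp⟩ := exists_polynomial_near_add_pow f (show 0 < ε / 8 by positivity)
  have hlim : Tendsto (fun n => ∫ y, p.eval y ∂(ν n : Measure ℝ)) atTop
      (𝓝 (∫ y, p.eval y ∂(μ : Measure ℝ))) := by
    simp only [heval _ hμ, heval _ (hν _)]
    exact tendsto_finsetSum _ fun i _ => (h i).const_mul _
  filter_upwards [Metric.tendsto_nhds.1 hlim (ε / 8) (by positivity),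
    (h (2 * k)).eventually_lt_const (show _ < (2 : ℝ) by linarith [hμ1 k])] with n h1 h2
  have h3 := abs_integral_eval_sub_le (ν n) (hν n) f hp
  have h4 := abs_integral_eval_sub_le μ hμ f hp
  have h5 : ε / 8 * ∫ y, y ^ (2 * k) ∂(ν n : Measure ℝ) ≤ ε / 8 * 2 := by gcongr
  have h6 : ε / 8 * ∫ y, y ^ (2 * k) ∂(μ : Measure ℝ) ≤ ε / 8 * 1 := by gcongr; exact hμ1 k
  rw [Real.dist_eq] at h1 ⊢
  rw [abs_le] at h3 h4
  rw [abs_lt] at h1 ⊢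
  constructor <;> linarith

end Moments

section Semicircle

open MeasureTheory Topology

/-- The integrals of `(2 x) ^ k * U_d x` against the semicircle law, where `U_d` are the Chebyshev
polynomials of the second kind, in the variable `x = cos θ`. -/
noncomputable def semicircleMoment (k d : ℕ) : ℝ :=
  (2 / Real.pi) * ∫ θ in (0 : ℝ)..Real.pi,
    (2 * Real.cos θ) ^ k * (Real.sin ((d + 1 : ℝ) * θ) * Real.sin θ)

theorem semicircleMoment_succ_zero (k : ℕ) :
    semicircleMoment (k + 1) 0 = semicircleMoment k 1 := by
  unfold semicircleMoment
  congr 2 with θ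
  have : ((1 : ℕ) + 1 : ℝ) * θ = 2 * θ := by norm_num
  rw [this, Real.sin_two_mul]
  simp only [Nat.cast_zero, zero_add, one_mul]
  ring

theorem semicircleMoment_succ_succ (k d : ℕ) : semicircleMoment (k + 1) (d + 1) =
    semicircleMoment k (d + 2) + semicircleMoment k d := by
  unfold semicircleMoment
  rw [← mul_add, ← intervalIntegral.integral_add
    (Continuous.intervalIntegrable (by fun_prop) _ _)
    (Continuous.intervalIntegrable (by fun_prop) _ _)]
  congr 2 with θ
  have h1 : (((d + 2 : ℕ) : ℝ) + 1) * θ = ((d + 1 : ℕ) + 1 : ℝ) * θ + θ := by push_cast; ring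
  have h2 : ((d : ℝ) + 1) * θ = ((d + 1 : ℕ) + 1 : ℝ) * θ - θ := by push_cast; ring
  rw [h1, h2, Real.sin_add, Real.sin_sub]
  ring

theorem semicircleMoment_zero_zero : semicircleMoment 0 0 = 1 := by
  unfold semicircleMoment
  have : ∀ θ : ℝ, (2 * Real.cos θ) ^ 0 * (Real.sin (((0 : ℕ) + 1 : ℝ) * θ) * Real.sin θ) =
      Real.sin θ ^ 2 := by intro θ; norm_num; ring
  simp only [this, integral_sin_sq]
  simp

theorem semicircleMoment_zero_succ (d : ℕ) : semicircleMoment 0 (d + 1) = 0 := by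
  unfold semicircleMoment
  have h : ∀ θ : ℝ, (2 * Real.cos θ) ^ 0 *
      (Real.sin (((d + 1 : ℕ) + 1 : ℝ) * θ) * Real.sin θ) =
      Real.cos ((d + 1 : ℝ) * θ) / 2 - Real.cos ((d + 3 : ℝ) * θ) / 2 := by
    intro θ
    have h1 : ((d : ℝ) + 3) * θ = ((d + 1 : ℕ) + 1 : ℝ) * θ + θ := by push_cast; ring
    have h2 : ((d : ℝ) + 1) * θ = ((d + 1 : ℕ) + 1 : ℝ) * θ - θ := by push_cast; ring
    rw [h1, h2, Real.cos_add, Real.cos_sub]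
    ring
  have h0 : ∀ j : ℕ, ∫ θ in (0 : ℝ)..Real.pi, Real.cos ((j + 1 : ℝ) * θ) = 0 := by
    intro j
    rw [intervalIntegral.integral_comp_mul_left (fun x => Real.cos x) (by positivity)]
    have : Real.sin ((j + 1 : ℝ) * Real.pi) = 0 := by exact_mod_cast Real.sin_nat_mul_pi (j + 1)
    simp [this]
  simp only [h]
  rw [intervalIntegral.integral_sub (Continuous.intervalIntegrable (by fun_prop) _ _)
    (Continuous.intervalIntegrable (by fun_prop) _ _), intervalIntegral.integral_div,
    intervalIntegral.integral_div, h0 d]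
  have := h0 (d + 2)
  push_cast at this
  rw [show (d : ℝ) + 3 = d + 2 + 1 by ring, this]
  simp

/-- The semicircle law on `[-1, 1]`. -/
noncomputable def semicircleMeasure : Measure ℝ :=
  volume.withDensity fun α => ENNReal.ofReal ((2 / Real.pi) * √(max (1 - α ^ 2) 0))

theorem integral_semicircleMeasure (f : ℝ → ℝ) : ∫ y, f y ∂semicircleMeasure =
    (2 / Real.pi) * ∫ y in (-1 : ℝ)..1, f y * √(max (1 - y ^ 2) 0) := by
  rw [semicircleMeasure, integral_withDensity_eq_integral_toReal_smul (by fun_prop) (by simp),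
    ← intervalIntegral.integral_const_mul, intervalIntegral.integral_of_le (by norm_num),
    ← setIntegral_eq_integral_of_forall_compl_eq_zero (s := Set.Ioc (-1 : ℝ) 1)]
  · refine integral_congr_ae (Eventually.of_forall fun y => ?_)
    simp only [smul_eq_mul]
    rw [ENNReal.toReal_ofReal (by positivity)]
    ring
  · intro y hy
    have : 1 - y ^ 2 ≤ 0 := by
      simp only [Set.mem_Ioc, not_and_or, not_lt, not_le] at hy
      rcases hy with hy | hy <;> nlinarith
    simp [max_eq_right this]

theorem semicircleMeasure_Icc {a b : ℝ} (hab : a ≤ b) : semicircleMeasure (Set.Icc a b) =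
    ENNReal.ofReal ((2 / Real.pi) * ∫ α in a..b, √(max (1 - α ^ 2) 0)) := by
  rw [semicircleMeasure, withDensity_apply _ measurableSet_Icc,
    ← intervalIntegral.integral_const_mul, intervalIntegral.integral_of_le hab,
    ← integral_Icc_eq_integral_Ioc, ofReal_integral_eq_lintegral_ofReal]
  · exact Continuous.integrableOn_Icc (by fun_prop)
  · exact Eventually.of_forall fun y => by positivity

theorem integral_pow_semicircleMeasure (k : ℕ) :
    ∫ y, (2 * y) ^ k ∂semicircleMeasure = semicircleMoment k 0 := by
  rw [integral_semicircleMeasure, semicircleMoment]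
  congr 1
  have h := intervalIntegral.integral_comp_mul_deriv (a := 0) (b := Real.pi) (f := Real.cos)
    (f' := fun θ => - Real.sin θ) (g := fun y => (2 * y) ^ k * √(max (1 - y ^ 2) 0))
    (fun θ _ => Real.hasDerivAt_cos θ) (by fun_prop) (by fun_prop)
  rw [Real.cos_zero, Real.cos_pi, intervalIntegral.integral_symm (-1) 1, ← neg_eq_iff_eq_neg,
    ← intervalIntegral.integral_neg] at h
  rw [← h]
  refine intervalIntegral.integral_congr fun θ hθ => ?_
  rw [Set.uIcc_of_le Real.pi_pos.le] at hθ
  have hs := Real.sin_nonneg_of_nonneg_of_le_pi hθ.1 hθ.2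
  have h2 : max (1 - Real.cos θ ^ 2) 0 = Real.sin θ ^ 2 := by
    rw [← Real.sin_sq, max_eq_left (sq_nonneg _)]
  simp only [Function.comp_apply, h2, Real.sqrt_sq hs, Nat.cast_zero, zero_add, one_mul]
  ring

instance : IsProbabilityMeasure semicircleMeasure := by
  have h_one : ∫ _y, (1 : ℝ) ∂semicircleMeasure = 1 := by
    simpa [semicircleMoment_zero_zero] using integral_pow_semicircleMeasure 0
  simp only [integral_const, smul_eq_mul, mul_one, Measure.real] at h_one
  exact ⟨(ENNReal.toReal_eq_one_iff _).1 h_one⟩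

theorem ae_semicircleMeasure : ∀ᵐ y ∂semicircleMeasure, y ∈ Set.Icc (-1 : ℝ) 1 := by
  rw [semicircleMeasure, ae_withDensity_iff (by fun_prop)]
  refine Eventually.of_forall fun y hy => ?_
  by_contra hc
  have : 1 - y ^ 2 ≤ 0 := by
    simp only [Set.mem_Icc, not_and_or, not_le] at hc
    rcases hc with hc | hc <;> nlinarith
  simp [max_eq_right this] at hy

theorem ae_abs_pow_le_semicircleMeasure (k : ℕ) : ∀ᵐ y ∂semicircleMeasure, |y ^ k| ≤ 1 := by
  filter_upwards [ae_semicircleMeasure] with y hy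
  rw [abs_pow]
  exact pow_le_one₀ (abs_nonneg _) (abs_le.2 hy)

theorem integrable_pow_semicircleMeasure (k : ℕ) :
    Integrable (fun y : ℝ => y ^ k) semicircleMeasure :=
  (integrable_const (1 : ℝ)).mono' (by fun_prop) (ae_abs_pow_le_semicircleMeasure k)

theorem integral_pow_semicircleMeasure_le_one (k : ℕ) : ∫ y, y ^ k ∂semicircleMeasure ≤ 1 := by
  have h := integral_mono_ae (integrable_pow_semicircleMeasure k) (integrable_const (1 : ℝ))
    ((ae_abs_pow_le_semicircleMeasure k).mono fun y hy => (le_abs_self _).trans hy)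
  simpa using h

theorem semicircleMeasure_frontier_Icc (a b : ℝ) :
    semicircleMeasure (frontier (Set.Icc a b)) = 0 := by
  refine withDensity_absolutelyContinuous _ _ ?_
  exact (convex_Icc a b).addHaar_frontier _

end Semicircle

section Spectrum

open MeasureTheory Topology

/-- Limits of a two-parameter family of sequences which satisfies, asymptotically, the recursion of
the moments of the semicircle law. -/
theorem tendsto_semicircleMoment {F : ℕ → ℕ → ℕ → ℂ} {c : ℕ → ℕ → ℂ}
    (hc : ∀ d, Tendsto (c d) atTop (𝓝 1))
    (h00 : Tendsto (F 0 0) atTop (𝓝 1)) (h0 : ∀ d, Tendsto (F 0 (d + 1)) atTop (𝓝 0))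
    (hF0 : ∀ k m, F (k + 1) 0 m = F k 1 m)
    (hF : ∀ k d m, F (k + 1) (d + 1) m = F k (d + 2) m + c d m * F k d m) (k d : ℕ) :
    Tendsto (F k d) atTop (𝓝 (semicircleMoment k d : ℂ)) := by
  induction k generalizing d with
  | zero =>
    cases d with
    | zero => simpa [semicircleMoment_zero_zero] using h00
    | succ d => simpa [semicircleMoment_zero_succ] using h0 d
  | succ k ih =>
    cases d with
    | zero =>
      rw [semicircleMoment_succ_zero]
      exact (ih 1).congr fun m => (hF0 k m).symm
    | succ d =>
      rw [semicircleMoment_succ_succ, Complex.ofReal_add]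
      have := (ih (d + 2)).add ((hc d).mul (ih d))
      rw [one_mul] at this
      exact this.congr fun m => (hF k d m).symm

/-- The sum of the matrices of the reduced words of length `d` in the star transpositions. -/
noncomputable def reducedMatrix (m d : ℕ) :
    Matrix (Perm (Fin (m + 1))) (Perm (Fin (m + 1))) ℂ :=
  reducedSum (fun i => leftRegularMatrix _ (swap 0 i)) (Finset.univ.erase (0 : Fin (m + 1))) d

theorem leftRegularMatrix_swap_mul_self {m : ℕ} (i : Fin (m + 1)) :
    leftRegularMatrix _ (swap 0 i) * leftRegularMatrix _ (swap 0 i) = 1 := by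
  rw [← map_mul, swap_mul_self, map_one]

theorem adjMatn_mul_reducedMatrix_zero (m : ℕ) :
    adjMatn (m + 1) * reducedMatrix m 0 = reducedMatrix m 1 := by
  rw [adjMatn_succ, reducedMatrix, sum_mul_reducedSum_zero, reducedMatrix]

theorem adjMatn_mul_reducedMatrix_succ (m d : ℕ) :
    adjMatn (m + 1) * reducedMatrix m (d + 1) =
      reducedMatrix m (d + 2) + ((m : ℂ) - if d = 0 then 0 else 1) • reducedMatrix m d := by
  have hcard : (Finset.univ.erase (0 : Fin (m + 1))).card = m := by simp
  cases d with
  | zero =>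
    rw [adjMatn_succ, reducedMatrix,
      sum_mul_reducedSum_one _ _ fun i _ => leftRegularMatrix_swap_mul_self i, hcard]
    simp [reducedMatrix, reducedSum, Nat.cast_smul_eq_nsmul]
  | succ d =>
    rw [adjMatn_succ, reducedMatrix,
      sum_mul_reducedSum_add_two _ _ fun i _ => leftRegularMatrix_swap_mul_self i, hcard]
    simp [reducedMatrix, sub_mul, sub_smul, ← nsmul_eq_mul, Nat.cast_smul_eq_nsmul]

theorem trace_reducedMatrix_zero (m : ℕ) : (reducedMatrix m 0).trace = (m + 1).factorial := by
  simp [reducedMatrix, reducedSum, Matrix.trace_one, Fintype.card_perm]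

theorem trace_reducedMatrix_succ (m d : ℕ) : (reducedMatrix m (d + 1)).trace =
    (m + 1).factorial *
      (trivialReducedWords 0 (Finset.univ.erase (0 : Fin (m + 1))) d).card := by
  have h : ∀ w : List (Fin (m + 1)),
      (w.map fun i => leftRegularMatrix (Perm (Fin (m + 1))) (swap 0 i)).prod =
        leftRegularMatrix _ (starProd 0 w) := by
    intro w
    rw [starProd, map_list_prod, List.map_map]
    rfl
  simp only [reducedMatrix, reducedSum, Matrix.trace_sum, h, trace_leftRegularMatrix]
  rw [← Finset.sum_biUnion (pairwiseDisjoint_reducedWords _ d), ← Finset.sum_filter,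
    ← trivialReducedWords, Finset.sum_const, nsmul_eq_mul, mul_comm, Fintype.card_perm,
    Fintype.card_fin]

/-- The normalised trace of `A ^ k` times the sum of the reduced words of length `d`. -/
noncomputable def mixedMoment (k d m : ℕ) : ℂ :=
  (adjMatn (m + 1) ^ k * reducedMatrix m d).trace /
    ((m + 1).factorial * (√(m + 1 : ℝ) : ℂ) ^ (k + d))

theorem sq_ofReal_sqrt_add_one (m : ℕ) : (√(m + 1 : ℝ) : ℂ) ^ 2 = m + 1 := by
  rw [← Complex.ofReal_pow, Real.sq_sqrt (by positivity)]
  push_cast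
  rfl

theorem mixedMoment_succ_zero (k m : ℕ) : mixedMoment (k + 1) 0 m = mixedMoment k 1 m := by
  simp only [mixedMoment, pow_succ, mul_assoc, adjMatn_mul_reducedMatrix_zero, add_zero]

theorem mixedMoment_succ_succ (k d m : ℕ) : mixedMoment (k + 1) (d + 1) m =
    mixedMoment k (d + 2) m +
      (((m : ℂ) - if d = 0 then 0 else 1) / (m + 1)) * mixedMoment k d m := by
  have h0 : (√(m + 1 : ℝ) : ℂ) ≠ 0 := by
    exact_mod_cast (Real.sqrt_pos.2 (by positivity : (0 : ℝ) < m + 1)).ne'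
  have hf : ((m + 1).factorial : ℂ) ≠ 0 := by exact_mod_cast (m + 1).factorial_ne_zero
  rw [← sq_ofReal_sqrt_add_one]
  simp only [mixedMoment, pow_succ (adjMatn (m + 1)), mul_assoc, adjMatn_mul_reducedMatrix_succ,
    mul_add, Matrix.trace_add, Matrix.mul_smul, Matrix.trace_smul, smul_eq_mul]
  field_simp
  ring

theorem norm_mixedMoment_zero_succ_le (d m : ℕ) :
    ‖mixedMoment 0 (d + 1) m‖ ≤ (d / 2 : ℕ) ^ (d + 1) / √(m + 1 : ℝ) := by
  have hf : ((m + 1).factorial : ℂ) ≠ 0 := by exact_mod_cast (m + 1).factorial_ne_zero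
  have hs : 1 ≤ √(m + 1 : ℝ) := by
    rw [Real.one_le_sqrt]
    linarith [(Nat.cast_nonneg m : (0 : ℝ) ≤ m)]
  rw [mixedMoment, pow_zero, one_mul, trace_reducedMatrix_succ, mul_div_mul_left _ _ hf, zero_add,
    norm_div, norm_pow, Complex.norm_real, Complex.norm_natCast, Real.norm_of_nonneg (by positivity)]
  have h1 := card_trivialReducedWords_le (x := (0 : Fin (m + 1)))
    (S := Finset.univ.erase 0) (by simp) d
  rw [show (Finset.univ.erase (0 : Fin (m + 1))).card = m by simp] at h1
  have h2 : ((trivialReducedWords 0 (Finset.univ.erase (0 : Fin (m + 1))) d).card : ℝ) ≤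
      (d / 2 : ℕ) ^ (d + 1) * (m : ℝ) ^ (d / 2) := by exact_mod_cast h1
  have h3 : (m : ℝ) ^ (d / 2) ≤ √(m + 1 : ℝ) ^ d := calc
    (m : ℝ) ^ (d / 2) ≤ (m + 1 : ℝ) ^ (d / 2) := by gcongr; linarith
    _ = √(m + 1 : ℝ) ^ (2 * (d / 2)) := by rw [pow_mul, Real.sq_sqrt (by positivity)]
    _ ≤ _ := pow_le_pow_right₀ hs (Nat.mul_div_le d 2)
  rw [div_le_div_iff₀ (by positivity) (by positivity), pow_succ √(m + 1 : ℝ), ← mul_assoc]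
  gcongr
  exact h2.trans (by gcongr)

theorem tendsto_sqrt_natCast_add_one : Tendsto (fun m : ℕ => √(m + 1 : ℝ)) atTop atTop :=
  Real.tendsto_sqrt_atTop.comp (tendsto_atTop_add_const_right _ _ tendsto_natCast_atTop_atTop)

theorem tendsto_mixedMoment (k d : ℕ) :
    Tendsto (mixedMoment k d) atTop (𝓝 (semicircleMoment k d : ℂ)) := by
  refine tendsto_semicircleMoment (fun d => ?_) ?_ (fun d => ?_) mixedMoment_succ_zero
    mixedMoment_succ_succ k d
  · have h1 : Tendsto (fun m : ℕ => 1 / ((m : ℂ) + 1)) atTop (𝓝 0) :=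
      tendsto_one_div_add_atTop_nhds_zero_nat
    have h2 : Tendsto (fun m : ℕ => 1 - (1 + if d = 0 then (0 : ℂ) else 1) * (1 / ((m : ℂ) + 1)))
        atTop (𝓝 (1 - (1 + if d = 0 then (0 : ℂ) else 1) * 0)) :=
      tendsto_const_nhds.sub (h1.const_mul _)
    rw [mul_zero, sub_zero] at h2
    refine h2.congr fun m => ?_
    have : (m : ℂ) + 1 ≠ 0 := by exact_mod_cast m.succ_ne_zero
    field_simp
    ring
  · refine tendsto_const_nhds.congr fun m => ?_
    have hf : ((m + 1).factorial : ℂ) ≠ 0 := by exact_mod_cast (m + 1).factorial_ne_zero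
    rw [mixedMoment, pow_zero, one_mul, trace_reducedMatrix_zero]
    simp [hf]
  · refine squeeze_zero_norm (norm_mixedMoment_zero_succ_le d) ?_
    exact tendsto_sqrt_natCast_add_one.const_div_atTop _

/-- The spectral measure of `G_n` for `n = m + 1`, rescaled by `1 / (2 √n)`. -/
noncomputable def spectralMeasure (m : ℕ) : Measure ℝ :=
  ((m + 1).factorial : ENNReal)⁻¹ •
    ∑ σ, Measure.dirac ((isHermitian_adjMatn m).eigenvalues σ / (2 * √(m + 1 : ℝ)))

instance (m : ℕ) : IsProbabilityMeasure (spectralMeasure m) := by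
  constructor
  have hf : ((m + 1).factorial : ENNReal) ≠ 0 := by exact_mod_cast (m + 1).factorial_ne_zero
  simp only [spectralMeasure, Measure.smul_apply, Measure.finsetSum_apply, measure_univ,
    Finset.sum_const, Finset.card_univ, Fintype.card_perm, Fintype.card_fin, smul_eq_mul,
    nsmul_eq_mul, mul_one]
  exact ENNReal.inv_mul_cancel hf (ENNReal.natCast_ne_top _)

theorem integrable_spectralMeasure (m : ℕ) (f : ℝ → ℝ) :
    Integrable f (spectralMeasure m) := by
  refine Integrable.smul_measure ?_
    (ENNReal.inv_ne_top.2 (by exact_mod_cast (m + 1).factorial_ne_zero))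
  rw [integrable_finsetSum_measure]
  exact fun σ _ => integrable_dirac (by simp)

theorem integral_spectralMeasure (m : ℕ) (f : ℝ → ℝ) :
    ∫ y, f y ∂(spectralMeasure m) = (1 / ((m + 1).factorial : ℝ)) *
      ∑ σ, f ((isHermitian_adjMatn m).eigenvalues σ / (2 * √(m + 1 : ℝ))) := by
  rw [spectralMeasure, integral_smul_measure,
    integral_finsetSum_measure fun σ _ => integrable_dirac (by simp)]
  simp

theorem integral_pow_spectralMeasure (m k : ℕ) :
    ((∫ y, (2 * y) ^ k ∂(spectralMeasure m) : ℝ) : ℂ) = mixedMoment k 0 m := by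
  rw [integral_spectralMeasure, mixedMoment, reducedMatrix, reducedSum, mul_one,
    trace_pow_adjMatn]
  have h : ∀ x : ℝ, (2 * (x / (2 * √(m + 1 : ℝ)))) ^ k = x ^ k / √(m + 1 : ℝ) ^ k := by
    intro x
    rw [← div_pow]
    congr 1
    field_simp
  simp only [h, ← Finset.sum_div]
  push_cast
  field_simp
  simp

theorem tendsto_integral_pow_spectralMeasure (k : ℕ) :
    Tendsto (fun m => ∫ y, y ^ k ∂(spectralMeasure m)) atTop
      (𝓝 (∫ y, y ^ k ∂semicircleMeasure)) := by
  have h1 : Tendsto (fun m => ∫ y, (2 * y) ^ k ∂(spectralMeasure m)) atTop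
      (𝓝 (∫ y, (2 * y) ^ k ∂semicircleMeasure)) := by
    rw [integral_pow_semicircleMeasure]
    have := (Complex.continuous_re.tendsto _).comp (tendsto_mixedMoment k 0)
    refine this.congr fun m => ?_
    rw [Function.comp_apply, ← integral_pow_spectralMeasure, Complex.ofReal_re]
  simp only [mul_pow, integral_const_mul] at h1
  have h2 := h1.const_mul ((2 : ℝ) ^ k)⁻¹
  simpa using h2

theorem real_spectralMeasure_Icc (m : ℕ) (a b : ℝ) : (spectralMeasure m).real (Set.Icc a b) =
    (1 / ((m + 1).factorial : ℝ)) *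
      ∑ l ∈ Finset.Icc ⌈2 * a * √(m + 1 : ℝ)⌉ ⌊2 * b * √(m + 1 : ℝ)⌋, (muln (m + 1) l : ℝ) := by
  rw [← Nat.cast_sum, sum_muln]
  simp only [Measure.real, spectralMeasure, Measure.smul_apply, Measure.finsetSum_apply,
    Measure.dirac_apply' _ measurableSet_Icc, smul_eq_mul, ENNReal.toReal_mul]
  simp only [Set.indicator_apply, Pi.one_apply, Finset.sum_boole, ENNReal.toReal_inv,
    ENNReal.toReal_natCast, one_div]
  congr 3
  ext σ
  obtain ⟨z, hz⟩ := exists_int_eigenvalues_adjMatn m σ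
  have hs : 0 < 2 * √(m + 1 : ℝ) := by positivity
  simp only [Finset.mem_filter, Finset.mem_univ, true_and, Set.mem_Icc, hz, Int.cast_le,
    Int.ceil_le, Int.le_floor, le_div_iff₀ hs, div_le_iff₀ hs]
  rw [← mul_assoc, ← mul_assoc, mul_comm a, mul_comm b]

end Spectrum

/-- Semicircle law for the spectrum of `G_n`: for all real `a < b`, the proportion
`(1/n!) · Σ_{2a√n ≤ l ≤ 2b√n} mul_n(l)` of eigenvalues lying in `[2a√n, 2b√n]` converges,
as `n → ∞`, to `(2/π) ∫_a^b √(max(1−α², 0)) dα`. -/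
theorem cayley_spectrum_semicircle (a b : ℝ) (hab : a < b) :
    Tendsto (fun n : ℕ =>
        (1 / (n.factorial : ℝ)) *
          ∑ l ∈ Finset.Icc ⌈2 * a * Real.sqrt n⌉ ⌊2 * b * Real.sqrt n⌋, (muln n l : ℝ))
      atTop
      (nhds ((2 / Real.pi) * ∫ α in a..b, Real.sqrt (max (1 - α ^ 2) 0))) := by
  rw [← tendsto_add_atTop_iff_nat 1]
  let ν : ℕ → MeasureTheory.ProbabilityMeasure ℝ := fun m => ⟨spectralMeasure m, inferInstance⟩
  let μ : MeasureTheory.ProbabilityMeasure ℝ := ⟨semicircleMeasure, inferInstance⟩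
  have hlim : Tendsto ν atTop (nhds μ) :=
    tendsto_of_tendsto_moments (fun m _ => integrable_spectralMeasure m _)
      integrable_pow_semicircleMeasure (fun k => integral_pow_semicircleMeasure_le_one _)
      tendsto_integral_pow_spectralMeasure
  have h := MeasureTheory.ProbabilityMeasure.tendsto_measure_of_null_frontier_of_tendsto' hlim
    (semicircleMeasure_frontier_Icc a b)
  have h2 := (ENNReal.tendsto_toReal (MeasureTheory.measure_ne_top semicircleMeasure _)).comp h
  rw [semicircleMeasure_Icc hab.le, ENNReal.toReal_ofReal (mul_nonneg (by positivity)
    (intervalIntegral.integral_nonneg hab.le fun _ _ => Real.sqrt_nonneg _))] at h2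
  refine h2.congr fun m => ?_
  rw [Nat.cast_add, Nat.cast_one]
  exact real_spectralMeasure_Icc m a b
end
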